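/- arXiv:1809.09205 — 4 statements merged into one kernel-verified Lean document; each statement's English description precedes it below -/
import Mathlib

section
/- For any 0 < r_1 < r_2 let D := {x ∈ ℝ² : r_1 ≤ |x| ≤ r_2} be the closed annulus. Then there is a constant c(r_1,r_2) > 0 depending only on r_1, r_2 such that for every positive integer n and every λ ∈ [r_1, r_2] there exists P ∈ 𝒫_n with P(y) = 1 whenever |y| = λ, and |P(y)| ≤ c(r_1,r_2) ρ_n*(λ − r_1) / (ρ_n*(λ − r_1) + |λ − |y||) for all y ∈ D. -/
open Set

/-- `ρ_n^*(t) = n⁻² + n⁻¹ √t`. -/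
noncomputable def rhoStar (n : ℕ) (t : ℝ) : ℝ := ((n : ℝ))⁻¹ ^ 2 + (n : ℝ)⁻¹ * Real.sqrt t

open Polynomial in
lemma aux_sin (k : ℕ) (a : ℝ) : |Real.sin (k * a)| ≤ k * |Real.sin a| := by
  induction k with
  | zero => simp
  | succ k ih =>
    have h : ((k + 1 : ℕ) : ℝ) * a = k * a + a := by push_cast; ring
    rw [h, Real.sin_add]
    have h1 : |Real.sin (k * a) * Real.cos a| ≤ |Real.sin (k * a)| := by
      rw [abs_mul]
      exact mul_le_of_le_one_right (abs_nonneg _) (Real.abs_cos_le_one a)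
    have h2 : |Real.cos (k * a) * Real.sin a| ≤ |Real.sin a| := by
      rw [abs_mul]
      exact mul_le_of_le_one_left (abs_nonneg _) (Real.abs_cos_le_one _)
    have h3 := abs_add_le (Real.sin (k * a) * Real.cos a) (Real.cos (k * a) * Real.sin a)
    push_cast
    linarith

lemma aux_cos (k : ℕ) (t : ℝ) : 1 - Real.cos (k * t) ≤ (k : ℝ) ^ 2 * (1 - Real.cos t) := by
  have h := aux_sin k (t / 2)
  have h1 : Real.cos (k * t) = 1 - 2 * Real.sin (k * (t / 2)) ^ 2 := by
    have : (k : ℝ) * t = 2 * (k * (t / 2)) := by ring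
    rw [this, Real.cos_two_mul, Real.cos_sq']; ring
  have h2 : Real.cos t = 1 - 2 * Real.sin (t / 2) ^ 2 := by
    have : t = 2 * (t / 2) := by ring
    conv_lhs => rw [this]
    rw [Real.cos_two_mul, Real.cos_sq']; ring
  rw [h1, h2]
  have h3 : |Real.sin (k * (t / 2))| ^ 2 ≤ (k * |Real.sin (t / 2)|) ^ 2 :=
    pow_le_pow_left₀ (abs_nonneg _) h 2
  rw [mul_pow, sq_abs, sq_abs] at h3
  nlinarith

open Polynomial in
lemma aux_fejer (k : ℕ) (hk : 0 < k) : ∃ F : ℝ[X], F.natDegree ≤ k - 1 ∧ F.eval 1 = 1 ∧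
    ∀ x ∈ Icc (-1 : ℝ) 1, 0 ≤ F.eval x ∧ F.eval x ≤ 1 ∧
      F.eval x * (1 - x) * (k : ℝ) ^ 2 ≤ 2 := by
  have hk' : (0 : ℝ) < (k : ℝ) ^ 2 := by positivity
  have hroot : (Chebyshev.T ℝ (k : ℤ) - 1).IsRoot 1 := by simp [IsRoot]
  obtain ⟨G, hG⟩ := dvd_iff_isRoot.mpr hroot
  have hdeg : G.natDegree ≤ k - 1 := by
    by_cases hG0 : G = 0
    · simp [hG0]
    have h1 : (Chebyshev.T ℝ (k : ℤ) - 1).natDegree ≤ k := by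
      refine (natDegree_sub_le _ _).trans ?_
      simp
    rw [hG, natDegree_mul (X_sub_C_ne_zero 1) hG0, natDegree_X_sub_C] at h1
    omega
  have hG1 : G.eval 1 = (k : ℝ) ^ 2 := by
    have h := congrArg (fun p => (derivative p).eval 1) hG
    simp [derivative_mul] at h
    rw [← h]
    simp [Chebyshev.derivative_T_eval_one]
  have hGx : ∀ x, G.eval x * (1 - x) = 1 - (Chebyshev.T ℝ (k : ℤ)).eval x := by
    intro x
    have h := congrArg (eval x) hG
    simp at h
    linarith
  refine ⟨C (((k : ℝ) ^ 2)⁻¹) * G, (natDegree_C_mul_le _ _).trans hdeg, ?_, ?_⟩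
  · rw [eval_C_mul, hG1]; exact inv_mul_cancel₀ hk'.ne'
  · rintro x ⟨hx1, hx2⟩
    rcases eq_or_lt_of_le hx2 with rfl | hx
    · rw [eval_C_mul, hG1, inv_mul_cancel₀ hk'.ne']; norm_num
    have hT := abs_le.mp (Chebyshev.abs_eval_T_real_le_one (k : ℤ) (abs_le.mpr ⟨hx1, hx2⟩))
    have hgx := hGx x
    have hb : 1 - (Chebyshev.T ℝ (k : ℤ)).eval x ≤ (k : ℝ) ^ 2 * (1 - x) := by
      have := aux_cos k (Real.arccos x)
      rw [Real.cos_arccos hx1 hx2] at this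
      have h2 := Chebyshev.T_real_cos (Real.arccos x) (k : ℤ)
      rw [Real.cos_arccos hx1 hx2] at h2
      rw [h2]; simpa using this
    have hpos : 0 < 1 - x := by linarith
    have hg0 : 0 ≤ G.eval x := by
      by_contra hneg
      push Not at hneg
      nlinarith [hT.2]
    have hg1 : G.eval x ≤ (k : ℝ) ^ 2 := by
      refine le_of_mul_le_mul_right ?_ hpos
      linarith
    rw [eval_C_mul]
    refine ⟨by positivity, ?_, ?_⟩
    · rw [inv_mul_le_iff₀ hk']; linarith
    · have : ((k : ℝ) ^ 2)⁻¹ * eval x G * (1 - x) * (k : ℝ) ^ 2 = eval x G * (1 - x) := by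
        field_simp
      rw [this, hgx]; linarith [hT.1]

open Polynomial in
lemma aux_even_mono (v : ℝ) (j : ℕ) : ∃ q : ℝ[X], q.natDegree ≤ j ∧
    ∀ u : ℝ, q.eval (u ^ 2) = ((u - v) ^ 2) ^ j + ((u + v) ^ 2) ^ j := by
  induction j using Nat.strong_induction_on with
  | _ j ih =>
    match j, ih with
    | 0, _ => exact ⟨C 2, by simp, by intro u; simp; norm_num⟩
    | 1, _ =>
      refine ⟨C 2 * X + C (2 * v ^ 2), by compute_degree, fun u => ?_⟩
      simp; ring
    | j + 2, ih =>
      obtain ⟨a, ha, ha'⟩ := ih j (by omega)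
      obtain ⟨b, hb, hb'⟩ := ih (j + 1) (by omega)
      refine ⟨(C 2 * X + C (2 * v ^ 2)) * b - (X - C (v ^ 2)) ^ 2 * a, ?_, fun u => ?_⟩
      · have h1 : (C 2 * X + C (2 * v ^ 2) : ℝ[X]).natDegree ≤ 1 := by compute_degree
        have h2 : ((X - C (v ^ 2)) ^ 2 : ℝ[X]).natDegree ≤ 2 := by compute_degree
        refine (natDegree_sub_le _ _).trans (max_le ?_ ?_)
        · exact natDegree_mul_le.trans (by omega)
        · exact natDegree_mul_le.trans (by omega)
      · simp only [eval_sub, eval_mul, eval_add, eval_C, eval_X, eval_pow, ha', hb']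
        ring

open Polynomial in
lemma aux_even (v : ℝ) (m : ℕ) (E : ℝ[X]) (hE : E.natDegree ≤ m) :
    ∃ q : ℝ[X], q.natDegree ≤ m ∧
    ∀ u : ℝ, q.eval (u ^ 2) = E.eval ((u - v) ^ 2) + E.eval ((u + v) ^ 2) := by
  choose A hA hA' using aux_even_mono v
  refine ⟨∑ j ∈ Finset.range (m + 1), C (E.coeff j) * A j, ?_, fun u => ?_⟩
  · refine natDegree_sum_le_of_forall_le _ _ fun j hj => ?_
    have := Finset.mem_range.mp hj
    exact (natDegree_C_mul_le _ _).trans ((hA j).trans (by omega))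
  · rw [eval_eq_sum_range' (Nat.lt_succ_of_le hE), eval_eq_sum_range' (Nat.lt_succ_of_le hE),
      ← Finset.sum_add_distrib, eval_finsetSum]
    refine Finset.sum_congr rfl fun j _ => ?_
    rw [eval_C_mul, hA']; ring

open Polynomial in
lemma aux_mv (r : ℝ) (m : ℕ) (q : ℝ[X]) (hq : q.natDegree ≤ m) :
    ∃ P : MvPolynomial (Fin 2) ℝ, P.totalDegree ≤ 2 * m ∧
    ∀ y : EuclideanSpace ℝ (Fin 2), MvPolynomial.eval y P = q.eval (‖y‖ ^ 2 - r) := by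
  set B : MvPolynomial (Fin 2) ℝ :=
    MvPolynomial.X 0 ^ 2 + MvPolynomial.X 1 ^ 2 - MvPolynomial.C r with hB
  have hBd : B.totalDegree ≤ 2 := by
    refine (MvPolynomial.totalDegree_sub _ _).trans (max_le ?_ (by simp))
    refine (MvPolynomial.totalDegree_add _ _).trans (max_le ?_ ?_) <;>
    · refine (MvPolynomial.totalDegree_pow _ _).trans ?_
      simp
  refine ⟨∑ j ∈ Finset.range (m + 1), MvPolynomial.C (q.coeff j) * B ^ j, ?_, fun y => ?_⟩
  · refine MvPolynomial.totalDegree_finsetSum_le fun j hj => ?_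
    have := Finset.mem_range.mp hj
    refine (MvPolynomial.totalDegree_mul _ _).trans ?_
    have h1 := MvPolynomial.totalDegree_pow B j
    have h2 : j * B.totalDegree ≤ m * 2 := Nat.mul_le_mul (by omega) hBd
    rw [MvPolynomial.totalDegree_C]
    omega
  · rw [eval_eq_sum_range' (Nat.lt_succ_of_le hq), map_sum]
    refine Finset.sum_congr rfl fun j _ => ?_
    simp [hB, EuclideanSpace.norm_sq_eq, Fin.sum_univ_two]

/-- The elementary estimate for one of the two terms. -/
lemma aux_est (r₁ S w β v d δ e ν k : ℝ) (hr₁ : 0 < r₁) (hS : 0 < S) (hw : 0 ≤ w) (hβ : 0 ≤ β)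
    (hv : 0 ≤ v) (hvβ : v ≤ w * β) (hd : 0 ≤ d) (hν : 0 < ν) (hk : ν ≤ 2 * k)
    (he0 : 0 ≤ e) (he1 : e ≤ 1) (hed : e * d ^ 2 * k ^ 2 ≤ 4 * S)
    (hδ : 2 * r₁ * δ ≤ d * (2 * v + d)) :
    e * ((ν⁻¹ ^ 2 + ν⁻¹ * β) + δ) ≤
      (1 + (8 * √S * w + 16 * S) / (2 * r₁)) * (ν⁻¹ ^ 2 + ν⁻¹ * β) := by
  have h1 : e * d ^ 2 ≤ 16 * S * ν⁻¹ ^ 2 := by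
    rw [inv_pow, ← div_eq_mul_inv, le_div_iff₀ (by positivity)]
    have : ν ^ 2 ≤ 4 * k ^ 2 := by nlinarith
    have h0 : 0 ≤ e * d ^ 2 := by positivity
    nlinarith [mul_le_mul_of_nonneg_left this h0]
  have h2 : e * d ≤ 4 * √S * ν⁻¹ := by
    refine le_of_sq_le_sq ?_ (by positivity)
    have : (4 * √S * ν⁻¹) ^ 2 = 16 * S * ν⁻¹ ^ 2 := by
      rw [mul_pow, mul_pow, Real.sq_sqrt hS.le]; norm_num
    rw [this]
    refine le_trans ?_ h1
    nlinarith [mul_nonneg (mul_nonneg he0 (sub_nonneg.2 he1)) (sq_nonneg d)]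
  have h3 : e * d * v ≤ 4 * √S * ν⁻¹ * (w * β) := by gcongr
  have h4 : e * (2 * r₁ * δ) ≤ e * (d * (2 * v + d)) := by gcongr
  have hi : 0 < ν⁻¹ := by positivity
  set ρ := ν⁻¹ ^ 2 + ν⁻¹ * β with hρ
  have hρ1 : ν⁻¹ ^ 2 ≤ ρ := by rw [hρ]; nlinarith [mul_nonneg hi.le hβ]
  have hρ2 : ν⁻¹ * β ≤ ρ := by rw [hρ]; nlinarith [sq_nonneg ν⁻¹]
  have hρ0 : 0 ≤ ρ := le_trans (by positivity) hρ1
  have h5 : e * δ ≤ (8 * √S * w + 16 * S) / (2 * r₁) * ρ := by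
    rw [div_mul_eq_mul_div, le_div_iff₀ (by positivity)]
    have a1 := mul_le_mul_of_nonneg_left hρ1 (by positivity : (0:ℝ) ≤ 16 * S)
    have a2 := mul_le_mul_of_nonneg_left hρ2 (by positivity : (0:ℝ) ≤ 8 * √S * w)
    linarith
  have h6 : e * ρ ≤ ρ := mul_le_of_le_one_left hρ0 he1
  linarith

set_option maxHeartbeats 2000000 in
open Polynomial in
theorem main_7 (r₁ r₂ : ℝ) (hr₁ : 0 < r₁) (hr₁₂ : r₁ < r₂) :
    ∃ c : ℝ, 0 < c ∧ ∀ n : ℕ, 0 < n → ∀ lam ∈ Icc r₁ r₂,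
      ∃ P : MvPolynomial (Fin 2) ℝ, P.totalDegree ≤ n ∧
        (∀ y : EuclideanSpace ℝ (Fin 2), ‖y‖ = lam → MvPolynomial.eval y P = 1) ∧
        (∀ y : EuclideanSpace ℝ (Fin 2), r₁ ≤ ‖y‖ → ‖y‖ ≤ r₂ →
          |MvPolynomial.eval y P| ≤
            c * rhoStar n (lam - r₁) / (rhoStar n (lam - r₁) + |lam - ‖y‖|)) := by
  have hS : 0 < r₂ ^ 2 - r₁ ^ 2 := by nlinarith
  set S := r₂ ^ 2 - r₁ ^ 2 with hSdef
  set w := √(2 * r₂) with hw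
  set K := 1 + (8 * √S * w + 16 * S) / (2 * r₁) with hK
  have hw0 : 0 ≤ w := Real.sqrt_nonneg _
  have hK0 : 0 < K := by positivity
  refine ⟨2 * K, by positivity, ?_⟩
  rintro n hn lam ⟨hl1, hl2⟩
  obtain ⟨F, hFd, hF1, hF⟩ := aux_fejer (n / 2 + 1) (by omega)
  set E : ℝ[X] := F.comp (C 1 - C (1 / (2 * S)) * X) with hE
  have hEe : ∀ z, E.eval z = F.eval (1 - z / (2 * S)) := by
    intro z; rw [hE, eval_comp]; congr 1; simp only [eval_sub, eval_mul, eval_C, eval_X]; ring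
  have hEd : E.natDegree ≤ n / 2 := by
    refine natDegree_comp_le.trans ?_
    have h1 : (C 1 - C (1 / (2 * S)) * X : ℝ[X]).natDegree ≤ 1 := by compute_degree
    calc _ ≤ (n / 2) * 1 := Nat.mul_le_mul (by omega) h1
      _ = _ := by omega
  have hE0 : E.eval 0 = 1 := by rw [hEe]; simpa using hF1
  have hEb : ∀ z, 0 ≤ z → z ≤ 4 * S → 0 ≤ E.eval z ∧ E.eval z ≤ 1 ∧
      E.eval z * z * ((n / 2 + 1 : ℕ) : ℝ) ^ 2 ≤ 4 * S := by
    intro z hz0 hz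
    have hmem : 1 - z / (2 * S) ∈ Icc (-1 : ℝ) 1 := by
      constructor
      · have : z / (2 * S) ≤ 2 := by rw [div_le_iff₀ (by positivity)]; linarith
        linarith
      · have : 0 ≤ z / (2 * S) := by positivity
        linarith
    obtain ⟨a, b, c⟩ := hF _ hmem
    rw [hEe]
    refine ⟨a, b, ?_⟩
    have h1 : 1 - (1 - z / (2 * S)) = z / (2 * S) := by ring
    rw [h1, mul_div_assoc', div_mul_eq_mul_div, div_le_iff₀ (by positivity)] at c
    linarith
  have hl : 0 ≤ lam ^ 2 - r₁ ^ 2 := by nlinarith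
  have hlS : lam ^ 2 - r₁ ^ 2 ≤ S := by rw [hSdef]; nlinarith
  set v := √(lam ^ 2 - r₁ ^ 2) with hvdef
  have hv0 : 0 ≤ v := Real.sqrt_nonneg _
  have hv2 : v ^ 2 = lam ^ 2 - r₁ ^ 2 := Real.sq_sqrt hl
  have hvβ : v ≤ w * √(lam - r₁) := by
    rw [hw, ← Real.sqrt_mul (by linarith), hvdef]
    apply Real.sqrt_le_sqrt
    nlinarith
  obtain ⟨q, hqd, hq⟩ := aux_even v (n / 2) E hEd
  set N := 1 + E.eval ((v + v) ^ 2) with hN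
  have hN1 : 1 ≤ N := by
    have := (hEb ((v + v) ^ 2) (by positivity) (by nlinarith)).1
    linarith
  obtain ⟨P, hPd, hP⟩ := aux_mv (r₁ ^ 2) (n / 2) (C N⁻¹ * q)
    ((natDegree_C_mul_le _ _).trans hqd)
  refine ⟨P, hPd.trans (by omega), fun y hy => ?_, fun y hy1 hy2 => ?_⟩
  · rw [hP, hy, ← hv2, eval_C_mul, hq, sub_self]
    norm_num [hE0]
    rw [← hN]
    exact inv_mul_cancel₀ (by linarith)
  · set s := ‖y‖ with hs
    have hs0 : 0 ≤ s ^ 2 - r₁ ^ 2 := by nlinarith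
    have hsS : s ^ 2 - r₁ ^ 2 ≤ S := by rw [hSdef]; nlinarith
    set u := √(s ^ 2 - r₁ ^ 2) with hudef
    have hu0 : 0 ≤ u := Real.sqrt_nonneg _
    have hu2 : u ^ 2 = s ^ 2 - r₁ ^ 2 := Real.sq_sqrt hs0
    obtain ⟨a0, a1, a2⟩ := hEb ((u - v) ^ 2) (by positivity) (by nlinarith [sq_nonneg (u + v)])
    obtain ⟨b0, b1, b2⟩ := hEb ((u + v) ^ 2) (by positivity) (by nlinarith [sq_nonneg (u - v)])
    have hnpos : (0 : ℝ) < n := by exact_mod_cast hn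
    have hnk : (n : ℝ) ≤ 2 * ((n / 2 + 1 : ℕ) : ℝ) := by
      exact_mod_cast (by omega : n ≤ 2 * (n / 2 + 1))
    have hδ : 2 * r₁ * |lam - s| ≤ |u - v| * (2 * v + |u - v|) := by
      have h1 : |u - v| * (u + v) = |lam - s| * (lam + s) := by
        have e1 : |u - v| * (u + v) = |(u - v) * (u + v)| := by
          rw [abs_mul, abs_of_nonneg (by linarith : 0 ≤ u + v)]
        have e2 : |lam - s| * (lam + s) = |(lam - s) * (lam + s)| := by
          rw [abs_mul, abs_of_nonneg (by linarith : 0 ≤ lam + s)]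
        rw [e1, e2]
        rw [← abs_neg]
        congr 1
        linear_combination hv2 - hu2
      have h2 : |u - v| * (u + v) ≤ |u - v| * (2 * v + |u - v|) := by
        refine mul_le_mul_of_nonneg_left ?_ (abs_nonneg _)
        linarith [le_abs_self (u - v)]
      have h3 : |lam - s| * (2 * r₁) ≤ |lam - s| * (lam + s) := by
        refine mul_le_mul_of_nonneg_left ?_ (abs_nonneg _)
        linarith
      linarith
    have key1 := aux_est r₁ S w √(lam - r₁) v |u - v| |lam - s| (E.eval ((u - v) ^ 2)) n
      ((n / 2 + 1 : ℕ) : ℝ) hr₁ hS hw0 (Real.sqrt_nonneg _) hv0 hvβ (abs_nonneg _) hnpos hnk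
      a0 a1 (by rw [sq_abs]; exact a2) hδ
    have key2 := aux_est r₁ S w √(lam - r₁) v |u - v| |lam - s| (E.eval ((u + v) ^ 2)) n
      ((n / 2 + 1 : ℕ) : ℝ) hr₁ hS hw0 (Real.sqrt_nonneg _) hv0 hvβ (abs_nonneg _) hnpos hnk
      b0 b1 (by
        rw [sq_abs]
        refine le_trans ?_ b2
        refine mul_le_mul_of_nonneg_right ?_ (sq_nonneg _)
        refine mul_le_mul_of_nonneg_left ?_ b0
        have huv := mul_nonneg hu0 hv0
        linarith [add_sq u v, sub_sq u v]) hδ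
    have hρ : 0 < rhoStar n (lam - r₁) := by unfold rhoStar; positivity
    have hPy : |MvPolynomial.eval y P| ≤ E.eval ((u - v) ^ 2) + E.eval ((u + v) ^ 2) := by
      rw [hP, ← hs, ← hu2, eval_C_mul, hq, abs_of_nonneg (by positivity)]
      exact mul_le_of_le_one_left (by positivity) (inv_le_one_of_one_le₀ hN1)
    rw [le_div_iff₀ (by positivity)]
    refine (mul_le_mul_of_nonneg_right hPy (by positivity)).trans ?_
    unfold rhoStar
    linarith

/-- **Lemma (radial polynomial on an annulus).** For `0 < r₁ < r₂` and
`D = {x ∈ ℝ² : r₁ ≤ |x| ≤ r₂}`, there is `c(r₁,r₂) > 0` such that for every `n ≥ 1` and every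
`λ ∈ [r₁,r₂]` there is `P ∈ 𝒫_n` with `P(y) = 1` whenever `|y| = λ` and
`|P(y)| ≤ c ρ_n^*(λ-r₁) / (ρ_n^*(λ-r₁) + |λ - |y||)` for all `y ∈ D`. -/
theorem stmt_7 (r₁ r₂ : ℝ) (hr₁ : 0 < r₁) (hr₁₂ : r₁ < r₂) :
    ∃ c : ℝ, 0 < c ∧ ∀ n : ℕ, 0 < n → ∀ lam ∈ Icc r₁ r₂,
      ∃ P : MvPolynomial (Fin 2) ℝ, P.totalDegree ≤ n ∧
        (∀ y : EuclideanSpace ℝ (Fin 2), ‖y‖ = lam → MvPolynomial.eval y P = 1) ∧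
        (∀ y : EuclideanSpace ℝ (Fin 2), r₁ ≤ ‖y‖ → ‖y‖ ≤ r₂ →
          |MvPolynomial.eval y P| ≤
            c * rhoStar n (lam - r₁) / (rhoStar n (lam - r₁) + |lam - ‖y‖|)) := by
  exact main_7 r₁ r₂ hr₁ hr₁₂
end

section
/- For any 0 < r_1 < r_2 let D := {x ∈ ℝ² : r_1 ≤ |x| ≤ r_2} be the closed annulus. Then there is a constant c(r_1,r_2) > 0 depending only on r_1, r_2 such that for every positive integer n and every x ∈ D, λ_n(D,x) ≤ c(r_1,r_2) n^{-1} ρ_n*(|x| − r_1). -/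
open MeasureTheory Set

/-- The Christoffel function (uniform weight) of a planar compact set:
`λ_n(D,x) = inf { ∫_D P(y)² dy : P ∈ 𝒫_n, P(x) = 1 }`. -/
noncomputable def christoffel (n : ℕ) (D : Set (EuclideanSpace ℝ (Fin 2)))
    (x : EuclideanSpace ℝ (Fin 2)) : ℝ :=
  sInf { I : ℝ | ∃ P : MvPolynomial (Fin 2) ℝ, P.totalDegree ≤ n ∧
    MvPolynomial.eval x P = 1 ∧ I = ∫ y in D, (MvPolynomial.eval y P) ^ 2 }


noncomputable def kerA (m : ℕ) : Polynomial ℝ :=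
  1 + ∑ k ∈ Finset.range m, 2 * (Polynomial.Chebyshev.T ℝ ((k + 1 : ℕ) : ℤ)).comp (1 - 2 * Polynomial.X)

lemma kerA_natDegree (m : ℕ) : (kerA m).natDegree ≤ m := by
  unfold kerA
  refine Polynomial.natDegree_add_le_of_degree_le (by simp) ?_
  refine Polynomial.natDegree_sum_le_of_forall_le _ _ (fun k hk => ?_)
  have hk' := Finset.mem_range.mp hk
  refine Polynomial.natDegree_mul_le.trans ?_
  have h1 : (2 : Polynomial ℝ).natDegree = 0 := Polynomial.natDegree_ofNat 2
  have h2 : (1 - 2 * Polynomial.X : Polynomial ℝ).natDegree ≤ 1 := by compute_degree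
  have h3 := Polynomial.natDegree_comp_le (p := Polynomial.Chebyshev.T ℝ ((k + 1 : ℕ) : ℤ))
    (q := (1 - 2 * Polynomial.X : Polynomial ℝ))
  have h4 : (Polynomial.Chebyshev.T ℝ ((k + 1 : ℕ) : ℤ)).natDegree = k + 1 := by
    simp [Polynomial.Chebyshev.natDegree_T]; omega
  rw [h4] at h3
  nlinarith

lemma kerA_zero (m : ℕ) : (kerA m).eval 0 = 2 * m + 1 := by
  simp [kerA, Polynomial.eval_finsetSum]; ring

lemma kerA_abs (m : ℕ) {w : ℝ} (h0 : 0 ≤ w) (h1 : w ≤ 1) : |(kerA m).eval w| ≤ 2 * m + 1 := by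
  induction m with
  | zero => simp [kerA]
  | succ m ih =>
    have : (kerA (m+1)).eval w = (kerA m).eval w + 2 * (Polynomial.Chebyshev.T ℝ ((m + 1 : ℕ) : ℤ)).eval (1 - 2 * w) := by
      simp [kerA, Finset.sum_range_succ, add_assoc]
    rw [this]
    have h2 := Polynomial.Chebyshev.abs_eval_T_real_le_one ((m + 1 : ℕ) : ℤ) (x := 1 - 2 * w) (by rw [abs_le]; constructor <;> linarith)
    rw [abs_le] at *
    push_cast at *
    constructor <;> linarith

lemma kerA_sin (m : ℕ) (φ : ℝ) : Real.sin φ * (kerA m).eval (Real.sin φ ^ 2) = Real.sin ((2 * m + 1) * φ) := by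
  induction m with
  | zero => simp [kerA]
  | succ m ih =>
    have : (kerA (m+1)).eval (Real.sin φ ^ 2) = (kerA m).eval (Real.sin φ ^ 2) + 2 * (Polynomial.Chebyshev.T ℝ ((m + 1 : ℕ) : ℤ)).eval (1 - 2 * Real.sin φ ^ 2) := by
      simp [kerA, Finset.sum_range_succ, add_assoc]
    have h2 : 1 - 2 * Real.sin φ ^ 2 = Real.cos (2 * φ) := by
      rw [Real.cos_two_mul, Real.cos_sq']; ring
    rw [this, mul_add, ih, h2, Polynomial.Chebyshev.T_real_cos]
    have e1 : (2 * (m:ℝ) + 1) * φ = (2 * m + 2) * φ - φ := by ring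
    have e2 : (2 * ((m + 1 : ℕ):ℝ) + 1) * φ = (2 * m + 2) * φ + φ := by push_cast; ring
    have e3 : (((m + 1 : ℕ) : ℤ) : ℝ) * (2 * φ) = (2 * m + 2) * φ := by push_cast; ring
    rw [e1, e2, e3, Real.sin_add, Real.sin_sub]; ring

lemma exists_ker (m : ℕ) : ∃ A : Polynomial ℝ, A.natDegree ≤ m ∧ A.eval 0 = 1 ∧
    ∀ w : ℝ, 0 ≤ w → w ≤ 1 → (A.eval w) ^ 2 ≤ 2 * (1 + (2 * m + 1) ^ 2 * w)⁻¹ := by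
  have hN : (0 : ℝ) < 2 * m + 1 := by positivity
  refine ⟨Polynomial.C ((2 * m + 1 : ℝ)⁻¹) * kerA m, ?_, ?_, ?_⟩
  · exact (Polynomial.natDegree_C_mul_le _ _).trans (kerA_natDegree m)
  · rw [Polynomial.eval_mul, Polynomial.eval_C, kerA_zero]; field_simp
  · intro w h0 h1
    rw [Polynomial.eval_mul, Polynomial.eval_C]
    have ha := kerA_abs m h0 h1
    have hb : w * (kerA m).eval w ^ 2 ≤ 1 := by
      have hs : Real.sin (Real.arcsin (√w)) = √w :=
        Real.sin_arcsin (by linarith [Real.sqrt_nonneg w]) (Real.sqrt_le_one.mpr h1)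
      have := kerA_sin m (Real.arcsin (√w))
      rw [hs, Real.sq_sqrt h0] at this
      have h3 : (√w * (kerA m).eval w) ^ 2 ≤ 1 := by
        rw [this]; exact Real.sin_sq_le_one _
      rwa [mul_pow, Real.sq_sqrt h0] at h3
    have hc : (kerA m).eval w ^ 2 ≤ (2 * m + 1) ^ 2 := sq_le_sq.mpr (by rwa [abs_of_pos hN])
    have hd : 0 < 1 + (2 * (m:ℝ) + 1) ^ 2 * w := by positivity
    rw [← div_eq_mul_inv, le_div_iff₀ hd, mul_pow, inv_pow, mul_assoc, inv_mul_le_iff₀ (by positivity)]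
    nlinarith [sq_nonneg (2 * (m:ℝ) + 1)]

lemma exists_even_pow (t : ℝ) (j : ℕ) : ∃ E : Polynomial ℝ, E.natDegree ≤ j ∧
    ∀ x : ℝ, E.eval (x ^ 2) = ((x - t) ^ 2) ^ j + ((x + t) ^ 2) ^ j := by
  induction j using Nat.strong_induction_on with
  | _ j ih =>
    match j, ih with
    | 0, _ => exact ⟨Polynomial.C 2, by simp, by intro x; simp; norm_num⟩
    | 1, _ =>
      refine ⟨2 * Polynomial.X + Polynomial.C (2 * t ^ 2), by compute_degree, ?_⟩
      intro x; simp; ring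
    | j + 2, ih =>
      obtain ⟨E0, d0, h0⟩ := ih j (by omega)
      obtain ⟨E1, d1, h1⟩ := ih (j + 1) (by omega)
      refine ⟨(2 * Polynomial.X + Polynomial.C (2 * t ^ 2)) * E1 - (Polynomial.X - Polynomial.C (t ^ 2)) ^ 2 * E0, ?_, ?_⟩
      · refine (Polynomial.natDegree_sub_le _ _).trans (max_le ?_ ?_)
        · refine Polynomial.natDegree_mul_le.trans ?_
          have : (2 * Polynomial.X + Polynomial.C (2 * t ^ 2)).natDegree ≤ 1 := by compute_degree
          omega
        · refine Polynomial.natDegree_mul_le.trans ?_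
          have : ((Polynomial.X - Polynomial.C (t ^ 2)) ^ 2).natDegree ≤ 2 := by compute_degree
          omega
      · intro x; simp [h0, h1]; ring

lemma exists_even (t : ℝ) (B : Polynomial ℝ) : ∃ E : Polynomial ℝ, E.natDegree ≤ B.natDegree ∧
    ∀ x : ℝ, E.eval (x ^ 2) = B.eval ((x - t) ^ 2) + B.eval ((x + t) ^ 2) := by
  choose e de he using exists_even_pow t
  refine ⟨∑ j ∈ Finset.range (B.natDegree + 1), Polynomial.C (B.coeff j) * e j, ?_, ?_⟩
  · refine Polynomial.natDegree_sum_le_of_forall_le _ _ (fun k hk => ?_)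
    have := Finset.mem_range.mp hk
    exact (Polynomial.natDegree_C_mul_le _ _).trans ((de k).trans (by omega))
  · intro x
    rw [Polynomial.eval_finsetSum, Polynomial.eval_eq_sum_range, Polynomial.eval_eq_sum_range, ← Finset.sum_add_distrib]
    refine Finset.sum_congr rfl (fun k _ => ?_)
    simp [he]; ring

lemma totalDegree_aeval_le (p : MvPolynomial (Fin 2) ℝ) (E : Polynomial ℝ) :
    (Polynomial.aeval p E).totalDegree ≤ E.natDegree * p.totalDegree := by
  rw [Polynomial.aeval_eq_sum_range]
  refine MvPolynomial.totalDegree_finsetSum_le (fun k hk => ?_)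
  have := Finset.mem_range.mp hk
  refine (MvPolynomial.totalDegree_smul_le _ _).trans ((MvPolynomial.totalDegree_pow _ _).trans ?_)
  exact Nat.mul_le_mul_right _ (by omega)

lemma eval_aeval_mv (p : MvPolynomial (Fin 2) ℝ) (E : Polynomial ℝ) (y : Fin 2 → ℝ) :
    MvPolynomial.eval y (Polynomial.aeval p E) = E.eval (MvPolynomial.eval y p) := by
  rw [Polynomial.aeval_eq_sum_range, Polynomial.eval_eq_sum_range]
  simp [MvPolynomial.smul_eval]

lemma lorentz_integrable (k z : ℝ) (hk : 0 < k) : Integrable (fun x : ℝ => (1 + k ^ 2 * (x - z) ^ 2)⁻¹) := by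
  have h := (integrable_inv_one_add_sq.comp_mul_left' hk.ne').comp_sub_right z
  simpa [mul_pow] using h

lemma lorentz_integral (k z : ℝ) (hk : 0 < k) : ∫ x : ℝ, (1 + k ^ 2 * (x - z) ^ 2)⁻¹ = Real.pi / k := by
  have h1 := integral_sub_right_eq_self (μ := volume) (fun x : ℝ => (1 + k ^ 2 * x ^ 2)⁻¹) z
  rw [h1]
  have h2 := Measure.integral_comp_mul_left (fun x : ℝ => (1 + x ^ 2)⁻¹) k
  simp only [mul_pow] at h2
  rw [h2, integral_univ_inv_one_add_sq, abs_of_pos (by positivity), smul_eq_mul]; field_simp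

lemma abs_sin_ge {θ : ℝ} (h1 : -Real.pi ≤ θ) (h2 : θ ≤ Real.pi) :
    (2 / Real.pi * θ) ^ 2 ≤ Real.sin θ ^ 2 ∨ (2 / Real.pi * (θ - Real.pi)) ^ 2 ≤ Real.sin θ ^ 2 ∨
    (2 / Real.pi * (θ - -Real.pi)) ^ 2 ≤ Real.sin θ ^ 2 := by
  have hp := Real.pi_pos
  by_cases h : |θ| ≤ Real.pi / 2
  · left
    have := Real.mul_abs_le_abs_sin h
    rw [← sq_abs (Real.sin θ), ← sq_abs (2 / Real.pi * θ), abs_mul, abs_of_pos (by positivity : 0 < 2 / Real.pi)]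
    gcongr
  · right
    push Not at h
    rcases le_total 0 θ with h0 | h0
    · left
      rw [abs_of_nonneg h0] at h
      have := Real.mul_le_sin (x := Real.pi - θ) (by linarith) (by linarith)
      rw [Real.sin_pi_sub] at this
      rw [← neg_sq (2 / Real.pi * (θ - Real.pi))]
      have h3 : 0 ≤ 2 / Real.pi * (Real.pi - θ) := by
        apply mul_nonneg (by positivity); linarith
      apply pow_le_pow_left₀ _ _ <;> linarith
    · right
      rw [abs_of_nonpos h0] at h
      have := Real.mul_le_sin (x := θ - -Real.pi) (by linarith) (by linarith)
      rw [show θ - -Real.pi = θ + Real.pi by ring, Real.sin_add_pi] at this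
      rw [← neg_sq (Real.sin θ)]
      have h3 : 0 ≤ 2 / Real.pi * (θ + Real.pi) := by
        apply mul_nonneg (by positivity); linarith
      rw [show θ - -Real.pi = θ + Real.pi by ring]
      apply pow_le_pow_left₀ _ _ <;> linarith

lemma angle_cont (K : ℝ) : Continuous (fun θ : ℝ => (1 + K ^ 2 * Real.sin θ ^ 2)⁻¹) := by
  refine Continuous.inv₀ (by fun_prop) (fun θ => ?_)
  positivity

lemma angle_integral (K : ℝ) (hK : 0 < K) (α : ℝ) :
    ∫ θ in Ioo (-Real.pi) Real.pi, (1 + K ^ 2 * Real.sin (θ - α) ^ 2)⁻¹ ≤ 3 * (Real.pi ^ 2 / (2 * K)) := by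
  have hp := Real.pi_pos
  have hper : Function.Periodic (fun θ : ℝ => (1 + K ^ 2 * Real.sin θ ^ 2)⁻¹) (2 * Real.pi) := by
    intro θ; simp
  have e1 : ∫ θ in Ioo (-Real.pi) Real.pi, (1 + K ^ 2 * Real.sin (θ - α) ^ 2)⁻¹
      = ∫ θ in (-Real.pi)..Real.pi, (1 + K ^ 2 * Real.sin θ ^ 2)⁻¹ := by
    rw [← integral_Ioc_eq_integral_Ioo, ← intervalIntegral.integral_of_le (by linarith)]
    rw [intervalIntegral.integral_comp_sub_right (fun θ => (1 + K ^ 2 * Real.sin θ ^ 2)⁻¹)]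
    have := hper.intervalIntegral_add_eq (-Real.pi - α) (-Real.pi)
    rw [show -Real.pi - α + 2 * Real.pi = Real.pi - α by ring, show -Real.pi + 2 * Real.pi = Real.pi by ring] at this
    exact this
  set k := K * (2 / Real.pi) with hk
  have hk0 : 0 < k := by positivity
  have hi := fun z => lorentz_integrable k z hk0
  rw [e1, intervalIntegral.integral_of_le (by linarith)]
  calc ∫ θ in Ioc (-Real.pi) Real.pi, (1 + K ^ 2 * Real.sin θ ^ 2)⁻¹
      ≤ ∫ θ in Ioc (-Real.pi) Real.pi, ((1 + k ^ 2 * (θ - 0) ^ 2)⁻¹ + (1 + k ^ 2 * (θ - Real.pi) ^ 2)⁻¹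
          + (1 + k ^ 2 * (θ - -Real.pi) ^ 2)⁻¹) := by
        refine setIntegral_mono_on ?_ (((hi _).add (hi _)).add (hi _)).integrableOn measurableSet_Ioc ?_
        · exact (angle_cont K).integrableOn_Ioc
        · intro θ hθ
          have key : ∀ u : ℝ, (2 / Real.pi * u) ^ 2 ≤ Real.sin θ ^ 2 →
            (1 + K ^ 2 * Real.sin θ ^ 2)⁻¹ ≤ (1 + k ^ 2 * u ^ 2)⁻¹ := by
            intro u hu
            apply inv_anti₀ (by positivity)
            rw [hk, mul_pow, mul_assoc, ← mul_pow]
            gcongr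
          have q1 : 0 ≤ (1 + k ^ 2 * (θ - 0) ^ 2)⁻¹ := by positivity
          have q2 : 0 ≤ (1 + k ^ 2 * (θ - Real.pi) ^ 2)⁻¹ := by positivity
          have q3 : 0 ≤ (1 + k ^ 2 * (θ - -Real.pi) ^ 2)⁻¹ := by positivity
          rcases abs_sin_ge hθ.1.le hθ.2 with h | h | h
          · have := key _ h
            rw [← sub_zero θ] at this
            simp only [sub_zero] at *
            linarith
          · have := key _ h; linarith
          · have := key _ h; linarith
    _ ≤ ∫ θ, ((1 + k ^ 2 * (θ - 0) ^ 2)⁻¹ + (1 + k ^ 2 * (θ - Real.pi) ^ 2)⁻¹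
          + (1 + k ^ 2 * (θ - -Real.pi) ^ 2)⁻¹) := by
        refine setIntegral_le_integral (((hi _).add (hi _)).add (hi _)) (.of_forall fun θ => ?_)
        simp only [Pi.zero_apply]; positivity
    _ = 3 * (Real.pi ^ 2 / (2 * K)) := by
        rw [integral_add (f := fun θ : ℝ => (1 + k ^ 2 * (θ - 0) ^ 2)⁻¹ + (1 + k ^ 2 * (θ - Real.pi) ^ 2)⁻¹)
          ((hi _).add (hi _)) (hi _), integral_add (hi _) (hi _)]
        rw [lorentz_integral _ _ hk0, lorentz_integral _ _ hk0, lorentz_integral _ _ hk0, hk]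
        field_simp; ring

lemma radial (r₁ r₂ : ℝ) (hr₁ : 0 < r₁) (hr₁₂ : r₁ < r₂) (E : Polynomial ℝ) (κ x₀ : ℝ) (hκ : 0 < κ) (hx₀ : 0 ≤ x₀)
    (hE : ∀ x, 0 ≤ x → x ≤ √(r₂ ^ 2 - r₁ ^ 2) → 0 ≤ E.eval (x ^ 2) ∧
      E.eval (x ^ 2) ≤ 4 * (1 + κ ^ 2 * (x - x₀) ^ 2)⁻¹) :
    ∫ r in Icc r₁ r₂, r * (E.eval (r ^ 2 - r₁ ^ 2)) ^ 2 ≤ 16 * (x₀ + 1 / κ) * (Real.pi / κ) := by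
  set L := √(r₂ ^ 2 - r₁ ^ 2) with hL
  have hL2 : L ^ 2 = r₂ ^ 2 - r₁ ^ 2 := Real.sq_sqrt (by nlinarith)
  have hL0 : 0 ≤ L := Real.sqrt_nonneg _
  have hpos : ∀ x : ℝ, 0 < x ^ 2 + r₁ ^ 2 := fun x => by positivity
  have hcv := intervalIntegral.integral_comp_mul_deriv (a := 0) (b := L)
    (f := fun x => √(x ^ 2 + r₁ ^ 2)) (f' := fun x => x / √(x ^ 2 + r₁ ^ 2))
    (g := fun r => r * (E.eval (r ^ 2 - r₁ ^ 2)) ^ 2)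
    (by
      intro x _
      have h1 : HasDerivAt (fun x : ℝ => x ^ 2 + r₁ ^ 2) (2 * x) x := by
        simpa using (hasDerivAt_pow 2 x).add_const (r₁ ^ 2)
      have := h1.sqrt (hpos x).ne'
      convert this using 1
      rw [mul_div_mul_left _ _ (two_ne_zero)])
    (by
      refine Continuous.continuousOn (Continuous.div continuous_id (by fun_prop) (fun x => ?_))
      exact (Real.sqrt_pos.mpr (hpos x)).ne')
    (by fun_prop)
  have e0 : √((0:ℝ) ^ 2 + r₁ ^ 2) = r₁ := by
    rw [show (0:ℝ) ^ 2 + r₁ ^ 2 = r₁ ^ 2 by ring, Real.sqrt_sq hr₁.le]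
  have eL : √(L ^ 2 + r₁ ^ 2) = r₂ := by
    rw [hL2, show r₂ ^ 2 - r₁ ^ 2 + r₁ ^ 2 = r₂ ^ 2 by ring, Real.sqrt_sq (by linarith)]
  rw [e0, eL] at hcv
  rw [integral_Icc_eq_integral_Ioc, ← intervalIntegral.integral_of_le hr₁₂.le, ← hcv]
  have e1 : ∀ x : ℝ, ((fun r => r * (E.eval (r ^ 2 - r₁ ^ 2)) ^ 2) ∘ fun x => √(x ^ 2 + r₁ ^ 2)) x
      * (x / √(x ^ 2 + r₁ ^ 2)) = x * E.eval (x ^ 2) ^ 2 := by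
    intro x
    have h := (Real.sqrt_pos.mpr (hpos x)).ne'
    simp only [Function.comp, Real.sq_sqrt (hpos x).le, add_sub_cancel_right]
    field_simp
  simp only [e1]
  have hint : Integrable (fun x : ℝ => 16 * (x₀ + 1 / κ) * (1 + κ ^ 2 * (x - x₀) ^ 2)⁻¹) :=
    (lorentz_integrable κ x₀ hκ).const_mul _
  rw [intervalIntegral.integral_of_le hL0]
  calc ∫ x in Ioc 0 L, x * E.eval (x ^ 2) ^ 2
      ≤ ∫ x in Ioc 0 L, 16 * (x₀ + 1 / κ) * (1 + κ ^ 2 * (x - x₀) ^ 2)⁻¹ := by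
        refine setIntegral_mono_on ?_ hint.integrableOn measurableSet_Ioc ?_
        · exact Continuous.integrableOn_Ioc (by fun_prop)
        · intro x hx
          obtain ⟨h1, h2⟩ := hE x hx.1.le hx.2
          set d := 1 + κ ^ 2 * (x - x₀) ^ 2 with hd
          have hd0 : 0 < d := by positivity
          have h3 : E.eval (x ^ 2) ^ 2 ≤ (4 * d⁻¹) ^ 2 := pow_le_pow_left₀ h1 h2 2
          have h4 : x ≤ (x₀ + 1 / κ) * d := by
            have a1 : κ * |x - x₀| ≤ d := by
              rw [hd, ← sq_abs (x - x₀)]; nlinarith [sq_nonneg (κ * |x - x₀| - 1), sq_nonneg (κ * |x - x₀|)]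
            have a2 : |x - x₀| ≤ 1 / κ * d := by
              rw [one_div, inv_mul_eq_div, le_div_iff₀ hκ]; linarith
            have a3 : 1 ≤ d := by rw [hd]; nlinarith [sq_nonneg (κ * (x - x₀))]
            nlinarith [le_abs_self (x - x₀)]
          calc x * E.eval (x ^ 2) ^ 2 ≤ ((x₀ + 1 / κ) * d) * (4 * d⁻¹) ^ 2 := by
                apply mul_le_mul h4 h3 (sq_nonneg _); positivity
            _ = 16 * (x₀ + 1 / κ) * d⁻¹ := by field_simp; ring
    _ ≤ ∫ x, 16 * (x₀ + 1 / κ) * (1 + κ ^ 2 * (x - x₀) ^ 2)⁻¹ := by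
        refine setIntegral_le_integral hint (.of_forall fun θ => ?_)
        simp only [Pi.zero_apply]; positivity
    _ = 16 * (x₀ + 1 / κ) * (Real.pi / κ) := by
        rw [integral_const_mul, lorentz_integral _ _ hκ]

lemma polar_bound (r₁ r₂ : ℝ) (hr₁ : 0 < r₁) (P : MvPolynomial (Fin 2) ℝ) (F G : ℝ → ℝ)
    (hF : IntegrableOn F (Icc r₁ r₂)) (hG : IntegrableOn G (Ioo (-Real.pi) Real.pi))
    (hP : ∀ r ∈ Icc r₁ r₂, ∀ θ, r * (MvPolynomial.eval ![r * Real.cos θ, r * Real.sin θ] P) ^ 2 ≤ F r * G θ) :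
    ∫ y in {y : EuclideanSpace ℝ (Fin 2) | r₁ ≤ ‖y‖ ∧ ‖y‖ ≤ r₂}, (MvPolynomial.eval y P) ^ 2 ≤
      (∫ r in Icc r₁ r₂, F r) * ∫ θ in Ioo (-Real.pi) Real.pi, G θ := by
  set D := {y : EuclideanSpace ℝ (Fin 2) | r₁ ≤ ‖y‖ ∧ ‖y‖ ≤ r₂} with hD
  have hDm : MeasurableSet D :=
    (measurableSet_le measurable_const measurable_norm).inter (measurableSet_le measurable_norm measurable_const)
  set f : EuclideanSpace ℝ (Fin 2) → ℝ := D.indicator (fun y => (MvPolynomial.eval y P) ^ 2) with hf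
  rw [← integral_indicator hDm]
  have h1 := ((EuclideanSpace.volume_preserving_symm_measurableEquiv_toLp (Fin 2)).symm).integral_comp
    (MeasurableEquiv.measurableEmbedding _) f
  have h2 := ((volume_preserving_finTwoArrow ℝ).symm).integral_comp
    (MeasurableEquiv.measurableEmbedding _) (fun v => f ((MeasurableEquiv.toLp 2 (Fin 2 → ℝ)).symm.symm v))
  rw [← h1, ← h2, ← integral_comp_polarCoord_symm, polarCoord_target]
  have hval : ∀ p : ℝ × ℝ, 0 < p.1 → f ((MeasurableEquiv.toLp 2 (Fin 2 → ℝ)).symm.symm (MeasurableEquiv.finTwoArrow.symm (polarCoord.symm p)))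
      = (Icc r₁ r₂).indicator (fun r => (MvPolynomial.eval ![r * Real.cos p.2, r * Real.sin p.2] P) ^ 2) p.1 := by
    intro p hp
    set y := ((MeasurableEquiv.toLp 2 (Fin 2 → ℝ)).symm.symm (MeasurableEquiv.finTwoArrow.symm (polarCoord.symm p))) with hy
    have y0 : y.ofLp = ![p.1 * Real.cos p.2, p.1 * Real.sin p.2] := by
      ext i; fin_cases i <;> rfl
    have hn : ‖y‖ = p.1 := by
      rw [EuclideanSpace.norm_eq, y0]
      simp only [Fin.sum_univ_two, Matrix.cons_val_zero, Matrix.cons_val_one, Real.norm_eq_abs, sq_abs]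
      rw [show (p.1 * Real.cos p.2) ^ 2 + (p.1 * Real.sin p.2) ^ 2 = p.1 ^ 2 * (Real.sin p.2 ^ 2 + Real.cos p.2 ^ 2) by ring,
        Real.sin_sq_add_cos_sq, mul_one, Real.sqrt_sq hp.le]
    rw [hf]
    by_cases h : p.1 ∈ Icc r₁ r₂
    · rw [indicator_of_mem h, indicator_of_mem (show y ∈ D by rw [hD, mem_ofPred_eq, hn]; exact h), y0]
    · rw [indicator_of_notMem h, indicator_of_notMem (show y ∉ D by rw [hD, mem_ofPred_eq, hn]; exact h)]
  have hI : IntegrableOn (fun r => (Icc r₁ r₂).indicator F r) (Ioi 0) :=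
    ((integrable_indicator_iff measurableSet_Icc).mpr hF).integrableOn
  have hFG : (∫ p in Ioi (0:ℝ) ×ˢ Ioo (-Real.pi) Real.pi, (Icc r₁ r₂).indicator F p.1 * G p.2)
      = (∫ r in Icc r₁ r₂, F r) * ∫ θ in Ioo (-Real.pi) Real.pi, G θ := by
    rw [Measure.volume_eq_prod, setIntegral_prod_mul, setIntegral_indicator measurableSet_Icc]
    congr 3
    rw [inter_eq_right]
    intro r hr; exact lt_of_lt_of_le hr₁ hr.1
  rw [← hFG]
  refine integral_mono_of_nonneg ?_ ?_ ?_
  · refine (ae_restrict_mem (measurableSet_Ioi.prod measurableSet_Ioo)).mono (fun p hp => ?_)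
    have hp1 : (0:ℝ) < p.1 := hp.1
    simp only [Pi.zero_apply, smul_eq_mul]
    rw [hval p hp1]
    exact mul_nonneg hp1.le (indicator_nonneg (fun _ _ => sq_nonneg _) _)
  · rw [Measure.volume_eq_prod, ← Measure.prod_restrict]
    exact Integrable.mul_prod hI hG
  · refine (ae_restrict_mem (measurableSet_Ioi.prod measurableSet_Ioo)).mono (fun p hp => ?_)
    have hp1 : (0:ℝ) < p.1 := hp.1
    simp only [smul_eq_mul]
    rw [hval p hp1]
    by_cases h : p.1 ∈ Icc r₁ r₂
    · rw [indicator_of_mem h, indicator_of_mem h]; exact hP p.1 h p.2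
    · rw [indicator_of_notMem h, indicator_of_notMem h]; simp

set_option maxHeartbeats 1000000 in
lemma main_bound (r₁ r₂ : ℝ) (hr₁ : 0 < r₁) (hr₁₂ : r₁ < r₂) (m n : ℕ) (hmn : 6 * m ≤ n)
    (x : EuclideanSpace ℝ (Fin 2)) (hx1 : r₁ ≤ ‖x‖) (hx2 : ‖x‖ ≤ r₂) :
    christoffel n {y : EuclideanSpace ℝ (Fin 2) | r₁ ≤ ‖y‖ ∧ ‖y‖ ≤ r₂} x ≤
      (16 * (√(‖x‖ ^ 2 - r₁ ^ 2) + 1 / ((2 * m + 1) / (2 * √(r₂ ^ 2 - r₁ ^ 2)))) *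
        (Real.pi / ((2 * m + 1) / (2 * √(r₂ ^ 2 - r₁ ^ 2))))) *
      (2 * (3 * (Real.pi ^ 2 / (2 * ((2 * m + 1) * (r₁ / r₂)))))) := by
  have hr₂ : 0 < r₂ := hr₁.trans hr₁₂
  set s := ‖x‖ with hs
  have hs0 : 0 < s := hr₁.trans_le hx1
  set L := √(r₂ ^ 2 - r₁ ^ 2) with hL
  have hL2 : L ^ 2 = r₂ ^ 2 - r₁ ^ 2 := Real.sq_sqrt (by nlinarith)
  have hL0 : 0 < L := Real.sqrt_pos.mpr (by nlinarith)
  set x₀ := √(s ^ 2 - r₁ ^ 2) with hx₀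
  have hx₀0 : 0 ≤ x₀ := Real.sqrt_nonneg _
  have hx₀2 : x₀ ^ 2 = s ^ 2 - r₁ ^ 2 := Real.sq_sqrt (by nlinarith)
  have hx₀L : x₀ ≤ L := Real.sqrt_le_sqrt (by nlinarith)
  set N : ℝ := 2 * m + 1 with hN
  have hN0 : 0 < N := by positivity
  set κ := N / (2 * L) with hκ
  have hκ0 : 0 < κ := by positivity
  set K := N * (r₁ / r₂) with hK
  have hK0 : 0 < K := by positivity
  have hs2 : s ^ 2 = x 0 ^ 2 + x 1 ^ 2 := by
    rw [hs, EuclideanSpace.norm_sq_eq]; simp [Fin.sum_univ_two]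
  obtain ⟨α, hc, hsn⟩ : ∃ α : ℝ, Real.cos α = x 0 / s ∧ Real.sin α = x 1 / s := by
    have hz : ‖(⟨x 0, x 1⟩ : ℂ)‖ = s := by
      rw [Complex.norm_def, Complex.normSq_mk, ← pow_two, ← pow_two, ← hs2, Real.sqrt_sq hs0.le]
    refine ⟨Complex.arg ⟨x 0, x 1⟩, ?_, ?_⟩
    · rw [Complex.cos_arg (by rw [← norm_pos_iff, hz]; exact hs0), hz]
    · rw [Complex.sin_arg, hz]
  obtain ⟨A, dA, A0, hA⟩ := exists_ker m
  obtain ⟨E, dE, hE⟩ := exists_even x₀ ((A.comp (Polynomial.C (1 / (4 * L ^ 2)) * Polynomial.X)) ^ 2)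
  have hS : ∀ z : ℝ, ((A.comp (Polynomial.C (1 / (4 * L ^ 2)) * Polynomial.X)) ^ 2).eval (z ^ 2)
      = (A.eval (z ^ 2 / (4 * L ^ 2))) ^ 2 := by
    intro z
    simp only [Polynomial.eval_pow, Polynomial.eval_comp, Polynomial.eval_mul, Polynomial.eval_C, Polynomial.eval_X]
    rw [show 1 / (4 * L ^ 2) * z ^ 2 = z ^ 2 / (4 * L ^ 2) by ring]
  simp only [hS] at hE
  have dE' : E.natDegree ≤ 2 * m := by
    refine dE.trans (Polynomial.natDegree_pow_le.trans (Nat.mul_le_mul_left _ (Polynomial.natDegree_comp_le.trans ?_)))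
    have : (Polynomial.C (1 / (4 * L ^ 2)) * Polynomial.X : Polynomial ℝ).natDegree ≤ 1 := (Polynomial.natDegree_C_mul_le _ _).trans Polynomial.natDegree_X_le
    nlinarith
  have hEb : ∀ z, 0 ≤ z → z ≤ L → 0 ≤ E.eval (z ^ 2) ∧
      E.eval (z ^ 2) ≤ 4 * (1 + κ ^ 2 * (z - x₀) ^ 2)⁻¹ := by
    intro z hz0 hzL
    rw [hE]
    refine ⟨by positivity, ?_⟩
    have b : ∀ u : ℝ, u ^ 2 ≤ 4 * L ^ 2 → (z - x₀) ^ 2 ≤ u ^ 2 →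
        (A.eval (u ^ 2 / (4 * L ^ 2))) ^ 2 ≤ 2 * (1 + κ ^ 2 * (z - x₀) ^ 2)⁻¹ := by
      intro u hu huz
      refine (hA _ (by positivity) ((div_le_one (by positivity)).mpr hu)).trans ?_
      have : (2 * (m:ℝ) + 1) ^ 2 * (u ^ 2 / (4 * L ^ 2)) = κ ^ 2 * u ^ 2 := by
        rw [hκ, hN]; field_simp; ring
      rw [this]
      gcongr
    have b1 := b (z - x₀) (by nlinarith) le_rfl
    have b2 := b (z + x₀) (by nlinarith) (by nlinarith)
    linarith
  set c := E.eval (x₀ ^ 2) with hcdef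
  have hc1 : 1 ≤ c := by
    rw [hcdef, hE, sub_self]
    simp only [ne_eq, OfNat.ofNat_ne_zero, not_false_eq_true, zero_pow, zero_div, A0, one_pow]
    nlinarith [sq_nonneg (A.eval ((x₀ + x₀) ^ 2 / (4 * L ^ 2)))]
  set ℓ : MvPolynomial (Fin 2) ℝ := MvPolynomial.X 0 ^ 2 + MvPolynomial.X 1 ^ 2 - MvPolynomial.C (r₁ ^ 2) with hℓ
  set v : MvPolynomial (Fin 2) ℝ := MvPolynomial.C (1 / r₂) *
    (MvPolynomial.C (x 0 / s) * MvPolynomial.X 1 - MvPolynomial.C (x 1 / s) * MvPolynomial.X 0) with hv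
  have dℓ : ℓ.totalDegree ≤ 2 := by
    refine (MvPolynomial.totalDegree_sub _ _).trans (max_le ((MvPolynomial.totalDegree_add _ _).trans (max_le ?_ ?_)) ?_)
    · exact (MvPolynomial.totalDegree_pow _ _).trans (by simp)
    · exact (MvPolynomial.totalDegree_pow _ _).trans (by simp)
    · rw [MvPolynomial.totalDegree_C]; omega
  have dv : v.totalDegree ≤ 1 := by
    refine (MvPolynomial.totalDegree_mul _ _).trans ?_
    rw [MvPolynomial.totalDegree_C, zero_add]
    refine (MvPolynomial.totalDegree_sub _ _).trans (max_le ?_ ?_)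
    · refine (MvPolynomial.totalDegree_mul _ _).trans (by simp)
    · refine (MvPolynomial.totalDegree_mul _ _).trans (by simp)
  set P : MvPolynomial (Fin 2) ℝ := MvPolynomial.C c⁻¹ * (Polynomial.aeval ℓ E * Polynomial.aeval (v ^ 2) A) with hP
  have dP : P.totalDegree ≤ n := by
    refine (MvPolynomial.totalDegree_mul _ _).trans ?_
    rw [MvPolynomial.totalDegree_C, zero_add]
    refine (MvPolynomial.totalDegree_mul _ _).trans ?_
    have t1 := totalDegree_aeval_le ℓ E
    have t2 := totalDegree_aeval_le (v ^ 2) A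
    have t3 := MvPolynomial.totalDegree_pow v 2
    have t4 : E.natDegree * ℓ.totalDegree ≤ (2 * m) * 2 := Nat.mul_le_mul dE' dℓ
    have t5 : A.natDegree * (v ^ 2).totalDegree ≤ m * 2 := Nat.mul_le_mul dA (by omega)
    omega
  have evP : ∀ y : Fin 2 → ℝ, MvPolynomial.eval y P = c⁻¹ * (E.eval (y 0 ^ 2 + y 1 ^ 2 - r₁ ^ 2) *
      A.eval ((1 / r₂ * (x 0 / s * y 1 - x 1 / s * y 0)) ^ 2)) := by
    intro y
    rw [hP, map_mul, map_mul, eval_aeval_mv, eval_aeval_mv, hℓ, hv]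
    simp only [map_add, map_sub, map_mul, map_pow, MvPolynomial.eval_X, MvPolynomial.eval_C]
  have hPx : MvPolynomial.eval x P = 1 := by
    rw [evP, ← hs2, ← hx₀2, show (1 / r₂ * (x 0 / s * x 1 - x 1 / s * x 0)) ^ 2 = 0 by ring, A0, mul_one]
    exact inv_mul_cancel₀ (by linarith)
  have hle : christoffel n {y : EuclideanSpace ℝ (Fin 2) | r₁ ≤ ‖y‖ ∧ ‖y‖ ≤ r₂} x ≤
      ∫ y in {y : EuclideanSpace ℝ (Fin 2) | r₁ ≤ ‖y‖ ∧ ‖y‖ ≤ r₂}, (MvPolynomial.eval y P) ^ 2 := by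
    refine csInf_le ⟨0, ?_⟩ ⟨P, dP, hPx, rfl⟩
    rintro I ⟨Q, -, -, rfl⟩
    exact integral_nonneg (fun y => sq_nonneg _)
  refine hle.trans ((polar_bound r₁ r₂ hr₁ P (fun r => r * (E.eval (r ^ 2 - r₁ ^ 2)) ^ 2)
    (fun θ => 2 * (1 + K ^ 2 * Real.sin (θ - α) ^ 2)⁻¹) ?_ ?_ ?_).trans ?_)
  · exact Continuous.integrableOn_Icc (by fun_prop)
  · have : Continuous (fun θ : ℝ => 2 * (1 + K ^ 2 * Real.sin (θ - α) ^ 2)⁻¹) :=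
      continuous_const.mul ((angle_cont K).comp (continuous_sub_right α))
    exact this.integrableOn_Icc.mono_set Ioo_subset_Icc_self
  · intro r hr θ
    have hr0 : 0 < r := hr₁.trans_le hr.1
    rw [evP, ← hc, ← hsn]
    simp only [Matrix.cons_val_zero, Matrix.cons_val_one]
    rw [show (r * Real.cos θ) ^ 2 + (r * Real.sin θ) ^ 2 = r ^ 2 * (Real.sin θ ^ 2 + Real.cos θ ^ 2) by ring,
        Real.sin_sq_add_cos_sq, mul_one,
      show 1 / r₂ * (Real.cos α * (r * Real.sin θ) - Real.sin α * (r * Real.cos θ)) = r / r₂ * Real.sin (θ - α) by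
        rw [Real.sin_sub]; ring]
    have hrr : r / r₂ ≤ 1 := (div_le_one hr₂).mpr hr.2
    have hrr0 : 0 < r / r₂ := by positivity
    have hsin := Real.sin_sq_le_one (θ - α)
    have hA' := hA ((r / r₂ * Real.sin (θ - α)) ^ 2) (sq_nonneg _) (by
      rw [mul_pow]; exact mul_le_one₀ (pow_le_one₀ hrr0.le hrr) (sq_nonneg _) hsin)
    have hA2 : A.eval ((r / r₂ * Real.sin (θ - α)) ^ 2) ^ 2 ≤ 2 * (1 + K ^ 2 * Real.sin (θ - α) ^ 2)⁻¹ := by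
      refine hA'.trans ?_
      have : K ^ 2 * Real.sin (θ - α) ^ 2 ≤ (2 * (m:ℝ) + 1) ^ 2 * (r / r₂ * Real.sin (θ - α)) ^ 2 := by
        rw [hK, mul_pow, mul_pow, mul_assoc]
        have := hr.1
        gcongr
      gcongr
    have hci : (c⁻¹) ^ 2 ≤ 1 := pow_le_one₀ (by positivity) (inv_le_one_of_one_le₀ hc1)
    calc r * (c⁻¹ * (E.eval (r ^ 2 - r₁ ^ 2) * A.eval ((r / r₂ * Real.sin (θ - α)) ^ 2))) ^ 2
        = (c⁻¹) ^ 2 * ((r * E.eval (r ^ 2 - r₁ ^ 2) ^ 2) * A.eval ((r / r₂ * Real.sin (θ - α)) ^ 2) ^ 2) := by ring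
      _ ≤ 1 * ((r * E.eval (r ^ 2 - r₁ ^ 2) ^ 2) * A.eval ((r / r₂ * Real.sin (θ - α)) ^ 2) ^ 2) := by gcongr
      _ ≤ _ := by rw [one_mul]; gcongr
  · rw [integral_const_mul]
    have R := radial r₁ r₂ hr₁ hr₁₂ E κ x₀ hκ0 hx₀0 hEb
    have T := angle_integral K hK0 α
    refine mul_le_mul R ?_ ?_ (by positivity)
    · gcongr
    · exact mul_nonneg (by norm_num) (integral_nonneg (fun θ => by simp only [Pi.zero_apply]; positivity))

/-- **Lemma (upper bound of the Christoffel function on an annulus).** For `0 < r₁ < r₂` and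
`D = {x ∈ ℝ² : r₁ ≤ |x| ≤ r₂}`, there is `c(r₁,r₂) > 0` such that
`λ_n(D,x) ≤ c n⁻¹ ρ_n^*(|x| - r₁)` for every `n ≥ 1` and every `x ∈ D`. -/
theorem stmt_8 (r₁ r₂ : ℝ) (hr₁ : 0 < r₁) (hr₁₂ : r₁ < r₂) :
    ∃ c : ℝ, 0 < c ∧ ∀ n : ℕ, 0 < n →
      ∀ x ∈ {y : EuclideanSpace ℝ (Fin 2) | r₁ ≤ ‖y‖ ∧ ‖y‖ ≤ r₂},
        christoffel n {y : EuclideanSpace ℝ (Fin 2) | r₁ ≤ ‖y‖ ∧ ‖y‖ ≤ r₂} x ≤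
          c * (n : ℝ)⁻¹ * rhoStar n (‖x‖ - r₁) := by
  have hr₂ : 0 < r₂ := hr₁.trans hr₁₂
  have hp := Real.pi_pos
  set L := √(r₂ ^ 2 - r₁ ^ 2) with hL
  have hL0 : 0 < L := Real.sqrt_pos.mpr (by nlinarith)
  set M := √(2 * r₂) + 12 * L with hM
  have hM0 : 0 < M := by positivity
  refine ⟨16 * M * (Real.pi * 12 * L) * (3 * Real.pi ^ 2 * 6 * (r₂ / r₁)), by positivity, ?_⟩
  intro n hn x hx
  obtain ⟨hx1, hx2⟩ := hx
  have hn0 : (0:ℝ) < n := by exact_mod_cast hn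
  refine (main_bound r₁ r₂ hr₁ hr₁₂ (n / 6) n (by omega) x hx1 hx2).trans ?_
  rw [← hL]
  set N : ℝ := 2 * ((n / 6 : ℕ) : ℝ) + 1 with hN
  have hN0 : 0 < N := by positivity
  have hNn : (n : ℝ) ≤ 6 * N := by
    have : n ≤ 6 * (2 * (n / 6) + 1) := by omega
    rw [hN]; exact_mod_cast this
  have hNi : 1 / N ≤ 6 * (n:ℝ)⁻¹ := by
    rw [← div_eq_mul_inv, div_le_div_iff₀ hN0 hn0]; linarith
  set t := ‖x‖ - r₁ with ht
  have ht0 : 0 ≤ t := by linarith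
  have hx0 : √(‖x‖ ^ 2 - r₁ ^ 2) ≤ √(2 * r₂) * √t := by
    rw [← Real.sqrt_mul (by positivity)]
    apply Real.sqrt_le_sqrt
    nlinarith
  have e1 : 1 / (N / (2 * L)) = 2 * L * (1 / N) := by field_simp
  have e2 : Real.pi / (N / (2 * L)) = Real.pi * 2 * L * (1 / N) := by field_simp
  have e3 : 2 * (3 * (Real.pi ^ 2 / (2 * (N * (r₁ / r₂))))) = 3 * Real.pi ^ 2 * (r₂ / r₁) * (1 / N) := by field_simp
  rw [e1, e2, e3]
  set i := (n:ℝ)⁻¹ with hi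
  have hi0 : 0 < i := by positivity
  have hst := Real.sqrt_nonneg t
  calc 16 * (√(‖x‖ ^ 2 - r₁ ^ 2) + 2 * L * (1 / N)) * (Real.pi * 2 * L * (1 / N)) * (3 * Real.pi ^ 2 * (r₂ / r₁) * (1 / N))
      ≤ 16 * (√(2 * r₂) * √t + 2 * L * (6 * i)) * (Real.pi * 2 * L * (6 * i)) * (3 * Real.pi ^ 2 * (r₂ / r₁) * (6 * i)) := by
        gcongr
    _ ≤ 16 * (M * (√t + i)) * (Real.pi * 2 * L * (6 * i)) * (3 * Real.pi ^ 2 * (r₂ / r₁) * (6 * i)) := by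
        gcongr
        rw [hM]
        have : 0 ≤ √(2 * r₂) * i := by positivity
        have : 0 ≤ L * √t := by positivity
        nlinarith
    _ = _ := by
        rw [rhoStar, ← hi]; ring
end

section
/- For every β ∈ (0,π) there exists a constant c̃(β) > 0, which may be taken decreasing as a function of β, such that for every positive integer n, every real trigonometric polynomial T_n of degree at most n, and every θ ∈ (−β,β), one has |T_n'(θ)| ≤ c̃(β) ‖T_n‖_{L∞([−β,β])} / ρ_n*(β − |θ|). -/
open Set

/-- A real trigonometric polynomial of degree at most `n`:
`T(θ) = a₀ + ∑_{j=1}^n (a_j cos(jθ) + b_j sin(jθ))`. -/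
def IsTrigPoly (n : ℕ) (T : ℝ → ℝ) : Prop :=
  ∃ a b : ℕ → ℝ, T = fun θ =>
    a 0 + ∑ j ∈ Finset.Icc 1 n, (a j * Real.cos (j * θ) + b j * Real.sin (j * θ))











lemma circle_max (p : Polynomial ℂ) (M : ℝ)
    (h : ∀ z : ℂ, ‖z‖ = 1 → ‖p.eval z‖ ≤ M) (z : ℂ) (hz : ‖z‖ ≤ 1) : ‖p.eval z‖ ≤ M := by
  refine Complex.norm_le_of_forall_mem_frontier_norm_le (U := Metric.ball (0:ℂ) 1)
    (f := fun z => p.eval z) Metric.isBounded_ball ?_ ?_ ?_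
  · exact p.differentiable.diffContOnCl
  · intro w hw
    rw [frontier_ball _ one_ne_zero] at hw
    exact h w (by simpa using hw)
  · rw [closure_ball _ one_ne_zero]; simpa using hz

lemma circle_bernstein (p : Polynomial ℂ) (d : ℕ) (hd : 0 < d) (hp : p.natDegree ≤ d) (M : ℝ)
    (h : ∀ z : ℂ, ‖z‖ = 1 → ‖p.eval z‖ ≤ M) (z : ℂ) (hz : ‖z‖ = 1) :
    ‖p.derivative.eval z‖ ≤ 3 * d * M := by
  have hM : 0 ≤ M := (norm_nonneg _).trans (h z hz)
  have hrev : ∀ w : ℂ, w ≠ 0 → p.eval w = (p.reflect d).eval w⁻¹ * w ^ d := by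
    intro w hw
    let _ : Invertible w := invertibleOfNonzero hw
    have := Polynomial.eval₂_reflect_mul_pow (RingHom.id ℂ) w d p hp
    rw [invOf_eq_inv] at this
    exact this.symm
  have hq : ∀ u : ℂ, ‖u‖ = 1 → ‖(p.reflect d).eval u‖ ≤ M := by
    intro u hu
    have hu0 : u ≠ 0 := by rintro rfl; simp at hu
    have h1 := hrev u⁻¹ (inv_ne_zero hu0)
    rw [inv_inv] at h1
    have h2 := h u⁻¹ (by simp [hu])
    rw [h1, norm_mul, norm_pow, norm_inv, hu] at h2
    simpa using h2
  have hd' : (0:ℝ) < d := by exact_mod_cast hd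
  have key : ∀ w ∈ Metric.sphere z (1 / (d:ℝ)), ‖p.eval w‖ ≤ 3 * M := by
    intro w hw
    rcases le_total ‖w‖ 1 with h1 | h1
    · have := circle_max p M h w h1
      linarith
    · have hw0 : w ≠ 0 := by rintro rfl; simp at h1; linarith
      rw [hrev w hw0, norm_mul, norm_pow]
      have h2 := circle_max _ M hq w⁻¹ (by rw [norm_inv]; exact inv_le_one_of_one_le₀ h1)
      have h3 : ‖w‖ ≤ 1 / (d:ℝ) + 1 := by
        have : ‖w - z‖ = 1 / (d:ℝ) := by simpa [dist_eq_norm] using hw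
        calc ‖w‖ = ‖(w - z) + z‖ := by ring_nf
          _ ≤ ‖w - z‖ + ‖z‖ := norm_add_le _ _
          _ = _ := by rw [this, hz]
      have h4 : ‖w‖ ^ d ≤ 3 := by
        calc ‖w‖ ^ d ≤ (Real.exp (1 / (d:ℝ))) ^ d := by
              gcongr; exact h3.trans (Real.add_one_le_exp _)
          _ = Real.exp 1 := by rw [← Real.exp_nat_mul]; congr 1; field_simp
          _ ≤ 3 := by have := Real.exp_one_lt_d9; linarith
      calc _ ≤ M * 3 := by gcongr
        _ = _ := by ring
  have := Complex.norm_deriv_le_of_forall_mem_sphere_norm_le (f := fun z => p.eval z) (c := z)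
    (R := 1 / (d:ℝ)) (C := 3 * M) (by positivity) p.differentiable.diffContOnCl key
  rw [Polynomial.deriv] at this
  refine this.trans (le_of_eq ?_)
  field_simp

/-- Trigonometric polynomials in complex form. -/
noncomputable def TP (N : ℕ) (p : Polynomial ℂ) (x : ℝ) : ℂ :=
  Complex.exp (-(N * x * Complex.I)) * p.eval (Complex.exp (x * Complex.I))

lemma TP_hasDerivAt (N : ℕ) (p : Polynomial ℂ) (x : ℝ) :
    HasDerivAt (TP N p)
      (TP N (Polynomial.C Complex.I * (Polynomial.X * p.derivative - Polynomial.C (N : ℂ) * p)) x) x := by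
  have h1 : HasDerivAt (fun x : ℝ => (x : ℂ)) 1 x := Complex.ofRealCLM.hasDerivAt
  have h2 : HasDerivAt (fun x : ℝ => Complex.exp (x * Complex.I))
      (Complex.exp (x * Complex.I) * (1 * Complex.I)) x := (h1.mul_const Complex.I).cexp
  have h3 : HasDerivAt (fun x : ℝ => Complex.exp (-(N * x * Complex.I)))
      (Complex.exp (-(N * x * Complex.I)) * -(N * 1 * Complex.I)) x :=
    (((h1.const_mul (N:ℂ)).mul_const Complex.I).neg).cexp
  have h4 := (p.hasDerivAt (Complex.exp (x * Complex.I))).scomp x h2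
  have h5 := h3.mul h4
  refine h5.congr_deriv ?_
  simp [TP]
  ring

lemma norm_TP (N : ℕ) (p : Polynomial ℂ) (x : ℝ) :
    ‖TP N p x‖ = ‖p.eval (Complex.exp (x * Complex.I))‖ := by
  rw [TP, norm_mul]
  have : ‖Complex.exp (-(N * x * Complex.I))‖ = 1 := by
    have := Complex.norm_exp_ofReal_mul_I (-(N * x))
    rw [← this]; congr 2; push_cast; ring
  rw [this, one_mul]

lemma TP_bernstein (N : ℕ) (hN : 0 < N) (p : Polynomial ℂ) (hp : p.natDegree ≤ 2 * N) (M : ℝ)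
    (h : ∀ x, ‖TP N p x‖ ≤ M) (x : ℝ) :
    ‖TP N (Polynomial.C Complex.I * (Polynomial.X * p.derivative - Polynomial.C (N : ℂ) * p)) x‖
      ≤ 7 * N * M := by
  have h' : ∀ z : ℂ, ‖z‖ = 1 → ‖p.eval z‖ ≤ M := by
    intro z hz
    have h1 := h (Complex.arg z)
    rw [norm_TP] at h1
    have h2 := Complex.norm_mul_exp_arg_mul_I z
    rw [hz] at h2
    simp only [Complex.ofReal_one, one_mul] at h2
    rwa [h2] at h1
  have hz := Complex.norm_exp_ofReal_mul_I x
  have h1 := circle_bernstein p (2 * N) (by omega) hp M h' _ hz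
  have h2 := h' _ hz
  rw [norm_TP]
  simp only [Polynomial.eval_mul, Polynomial.eval_C, Polynomial.eval_sub, Polynomial.eval_X, norm_mul,
    Complex.norm_I, one_mul]
  refine (norm_sub_le _ _).trans ?_
  rw [norm_mul, norm_mul, hz, one_mul, Complex.norm_natCast]
  push_cast at h1
  have : (N:ℝ) * ‖p.eval (Complex.exp (x * Complex.I))‖ ≤ N * M := by gcongr
  linarith

lemma TP_deg (N : ℕ) (p : Polynomial ℂ) (hp : p.natDegree ≤ 2 * N) :
    (Polynomial.C Complex.I * (Polynomial.X * p.derivative - Polynomial.C (N : ℂ) * p)).natDegree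
      ≤ 2 * N := by
  refine (Polynomial.natDegree_C_mul_le _ _).trans ?_
  refine (Polynomial.natDegree_sub_le _ _).trans (max_le ?_ ((Polynomial.natDegree_C_mul_le _ _).trans hp))
  by_cases h0 : p.natDegree = 0
  · rw [Polynomial.derivative_of_natDegree_zero h0]; simp
  · refine Polynomial.natDegree_mul_le.trans ?_
    have := Polynomial.natDegree_derivative_lt h0
    rw [Polynomial.natDegree_X]; omega

lemma exists_TP (N : ℕ) (P : Polynomial ℝ) (hP : P.natDegree ≤ N) :
    ∃ p : Polynomial ℂ, p.natDegree ≤ 2 * N ∧ ∀ x : ℝ, TP N p x = ((P.eval (Real.cos x) : ℝ) : ℂ) := by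
  refine ⟨∑ k ∈ Finset.range (N + 1), Polynomial.C (P.coeff k : ℂ) *
    (Polynomial.X ^ (N - k) * (Polynomial.C (1/2) * (Polynomial.X ^ 2 + 1)) ^ k), ?_, ?_⟩
  · refine Polynomial.natDegree_sum_le_of_forall_le _ _ ?_
    intro k hk
    rw [Finset.mem_range] at hk
    refine (Polynomial.natDegree_C_mul_le _ _).trans ?_
    refine Polynomial.natDegree_mul_le.trans ?_
    have h1 : (Polynomial.X ^ (N - k) : Polynomial ℂ).natDegree ≤ N - k := by simp
    have h2 : ((Polynomial.C (1/2) * (Polynomial.X ^ 2 + 1) : Polynomial ℂ) ^ k).natDegree ≤ k * 2 := by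
      refine Polynomial.natDegree_pow_le.trans ?_
      gcongr
      refine (Polynomial.natDegree_C_mul_le _ _).trans ?_
      compute_degree
    omega
  · intro x
    rw [TP, Polynomial.eval_eq_sum_range' (p := P) (n := N + 1) (by omega), Polynomial.eval_finsetSum]
    push_cast
    rw [Finset.mul_sum]
    refine Finset.sum_congr rfl fun k hk => ?_
    rw [Finset.mem_range] at hk
    simp only [Polynomial.eval_mul, Polynomial.eval_C, Polynomial.eval_pow, Polynomial.eval_X,
      Polynomial.eval_add, Polynomial.eval_one]
    have hc : (1/2 : ℂ) * (Complex.exp (x * Complex.I) ^ 2 + 1)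
        = Complex.exp (x * Complex.I) * Complex.cos x := by
      rw [Complex.cos]
      have : Complex.exp (x * Complex.I) * Complex.exp (-x * Complex.I) = 1 := by
        rw [← Complex.exp_add]; simp
      linear_combination (-1/2 : ℂ) * this
    rw [hc, mul_pow]
    have h1 : Complex.exp (x * Complex.I) ^ (N - k) * Complex.exp (x * Complex.I) ^ k
        = Complex.exp (x * Complex.I) ^ N := by
      rw [← pow_add]; congr 1; omega
    have h2 : Complex.exp (-(N * x * Complex.I)) * Complex.exp (x * Complex.I) ^ N = 1 := by
      rw [← Complex.exp_nat_mul, ← Complex.exp_add]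
      ring_nf; simp
    linear_combination (P.coeff k : ℂ) * Complex.cos x ^ k * Complex.exp (-(N * x * Complex.I)) * h1
      + (P.coeff k : ℂ) * Complex.cos x ^ k * h2

lemma poly_ineq (N : ℕ) (hN : 0 < N) (P : Polynomial ℝ) (hP : P.natDegree ≤ N) (M : ℝ)
    (h : ∀ x, |x| ≤ 1 → |P.eval x| ≤ M) (φ : ℝ) :
    |Real.sin φ * P.derivative.eval (Real.cos φ)| ≤ 7 * N * M ∧
    |Real.sin φ * P.derivative.eval (Real.cos φ)| ≤ 49 * N ^ 2 * M * |φ| := by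
  obtain ⟨p, hp, hpe⟩ := exists_TP N P hP
  have hM : ∀ x, ‖TP N p x‖ ≤ M := by
    intro x
    rw [hpe, Complex.norm_real]
    exact h _ (Real.abs_cos_le_one x)
  have h1 := TP_bernstein N hN p hp M hM
  have d1 := TP_hasDerivAt N p
  have e1 := TP_deg N p hp
  generalize Polynomial.C Complex.I * (Polynomial.X * p.derivative - Polynomial.C (N : ℂ) * p) = p1
    at h1 d1 e1
  have h2 := TP_bernstein N hN p1 e1 _ h1
  have d2 := TP_hasDerivAt N p1
  have heq : ∀ x, TP N p1 x = ((-(Real.sin x * P.derivative.eval (Real.cos x)) : ℝ) : ℂ) := by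
    intro x
    have a1 : HasDerivAt (fun x => P.eval (Real.cos x))
        (-(Real.sin x * P.derivative.eval (Real.cos x))) x := by
      have := (P.hasDerivAt (Real.cos x)).comp x (Real.hasDerivAt_cos x)
      refine this.congr_deriv ?_
      ring
    have a2 := a1.ofReal_comp
    have a3 : TP N p = fun y => ((P.eval (Real.cos y) : ℝ) : ℂ) := funext hpe
    have a4 := d1 x
    rw [a3] at a4
    exact a4.unique a2
  have hn : ∀ x, ‖TP N p1 x‖ = |Real.sin x * P.derivative.eval (Real.cos x)| := by
    intro x; rw [heq, Complex.norm_real, norm_neg, Real.norm_eq_abs]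
  constructor
  · rw [← hn]; exact h1 φ
  · have := Convex.norm_image_sub_le_of_norm_hasDerivWithin_le (s := Set.univ) (x := 0) (y := φ)
      (fun x _ => (d2 x).hasDerivWithinAt) (fun x _ => h2 x) convex_univ trivial trivial
    have h0 : TP N p1 0 = 0 := by rw [heq]; simp
    rw [h0, sub_zero, sub_zero, hn, Real.norm_eq_abs] at this
    refine this.trans (le_of_eq ?_)
    ring

lemma poly_markov_pos (N : ℕ) (hN : 0 < N) (P : Polynomial ℝ) (hP : P.natDegree ≤ N) (M : ℝ)
    (h : ∀ x, |x| ≤ 1 → |P.eval x| ≤ M) (x : ℝ) (hx0 : 0 ≤ x) (hx1 : x < 1) :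
    |P.derivative.eval x| ≤ 78 * N ^ 2 * M := by
  have hM : 0 ≤ M := (abs_nonneg _).trans (h 0 (by simp))
  have h2 := (poly_ineq N hN P hP M h (Real.arccos x)).2
  have hpos : 0 < Real.arccos x := Real.arccos_pos.2 hx1
  have hle : Real.arccos x ≤ Real.pi / 2 := Real.arccos_le_pi_div_two.2 hx0
  have hs := Real.mul_le_sin hpos.le hle
  rw [Real.cos_arccos (by linarith) hx1.le, abs_mul, abs_of_pos hpos] at h2
  set φ := Real.arccos x
  have hpi := Real.pi_pos
  have hpi2 := Real.pi_lt_d2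
  have hs0 : 0 < Real.sin φ := lt_of_lt_of_le (by positivity) hs
  rw [abs_of_pos hs0] at h2
  have h3 : 2 / Real.pi * φ * |P.derivative.eval x| ≤ 49 * N ^ 2 * M * φ :=
    le_trans (by gcongr) h2
  have h4 : 2 / Real.pi * |P.derivative.eval x| ≤ 49 * N ^ 2 * M := by
    have : (2 / Real.pi * |P.derivative.eval x|) * φ ≤ (49 * N ^ 2 * M) * φ := by linarith
    exact le_of_mul_le_mul_right this hpos
  have h5 : |P.derivative.eval x| ≤ 49 * N ^ 2 * M * (Real.pi / 2) := by
    calc |P.derivative.eval x| = (2 / Real.pi * |P.derivative.eval x|) * (Real.pi / 2) := by field_simp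
      _ ≤ _ := by gcongr
  have h6 : 49 * N ^ 2 * M * (Real.pi / 2) ≤ 49 * N ^ 2 * M * (3.15 / 2) := by gcongr
  have : 0 ≤ (N:ℝ) ^ 2 * M := by positivity
  linarith

lemma poly_markov (N : ℕ) (hN : 0 < N) (P : Polynomial ℝ) (hP : P.natDegree ≤ N) (M : ℝ)
    (h : ∀ x, |x| ≤ 1 → |P.eval x| ≤ M) (x : ℝ) (hx1 : |x| < 1) :
    |P.derivative.eval x| ≤ 78 * N ^ 2 * M := by
  rw [abs_lt] at hx1
  rcases le_total 0 x with h0 | h0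
  · exact poly_markov_pos N hN P hP M h x h0 hx1.2
  · have := poly_markov_pos N hN (P.comp (-Polynomial.X)) (by
      rw [Polynomial.natDegree_comp]; simpa using hP) M (by
      intro y hy; simpa using h (-y) (by simpa using hy)) (-x) (by linarith) (by linarith)
    simpa [Polynomial.derivative_comp] using this

lemma poly_bern (N : ℕ) (hN : 0 < N) (P : Polynomial ℝ) (hP : P.natDegree ≤ N) (M : ℝ)
    (h : ∀ x, |x| ≤ 1 → |P.eval x| ≤ M) (x : ℝ) (hx1 : |x| < 1) :
    √(1 - x ^ 2) * |P.derivative.eval x| ≤ 7 * N * M := by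
  rw [abs_lt] at hx1
  have h2 := (poly_ineq N hN P hP M h (Real.arccos x)).1
  rw [Real.cos_arccos hx1.1.le hx1.2.le, Real.sin_arccos, abs_mul, abs_of_nonneg (Real.sqrt_nonneg _)] at h2
  exact h2

lemma poly_scaled (N : ℕ) (hN : 0 < N) (P : Polynomial ℝ) (hP : P.natDegree ≤ N) (M a : ℝ) (ha : 0 < a)
    (h : ∀ x, |x| ≤ a → |P.eval x| ≤ M) (x : ℝ) (hx : |x| < a) :
    √(a ^ 2 - x ^ 2) * |P.derivative.eval x| ≤ 7 * N * M ∧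
      a * |P.derivative.eval x| ≤ 78 * N ^ 2 * M := by
  set Q := P.comp (Polynomial.C a * Polynomial.X) with hQ
  have hQd : Q.natDegree ≤ N := by
    rw [hQ, Polynomial.natDegree_comp, Polynomial.natDegree_C_mul_X _ ha.ne']; simpa using hP
  have hQe : ∀ x, |x| ≤ 1 → |Q.eval x| ≤ M := by
    intro y hy
    have := h (a * y) (by rw [abs_mul, abs_of_pos ha]; nlinarith)
    simpa [hQ] using this
  have hy : |x / a| < 1 := by rw [abs_div, abs_of_pos ha, div_lt_one ha]; exact hx
  have hd : Q.derivative.eval (x / a) = a * P.derivative.eval x := by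
    simp [hQ, Polynomial.derivative_comp, mul_div_cancel₀ _ ha.ne']
  have b1 := poly_bern N hN Q hQd M hQe _ hy
  have b2 := poly_markov N hN Q hQd M hQe _ hy
  rw [hd, abs_mul, abs_of_pos ha] at b1 b2
  refine ⟨?_, b2⟩
  have : √(a ^ 2 - x ^ 2) = √(1 - (x / a) ^ 2) * a := by
    rw [← Real.sqrt_sq ha.le, ← Real.sqrt_mul' _ (by positivity), Real.sqrt_sq ha.le]
    congr 1; field_simp
  rw [this, mul_assoc]; exact b1

lemma trig_decomp (n : ℕ) (T : ℝ → ℝ) (hT : IsTrigPoly n T) :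
    ∃ P R : Polynomial ℝ, P.natDegree ≤ 2 * n ∧ R.natDegree ≤ 2 * n ∧
      (∀ x, P.eval (-x) = P.eval x) ∧ (∀ x, R.eval (-x) = -R.eval x) ∧
      ∀ θ, T θ = P.eval (Real.sin (θ / 2)) + Real.cos (θ / 2) * R.eval (Real.sin (θ / 2)) := by
  obtain ⟨a, b, rfl⟩ := hT
  have hX : (1 - 2 * Polynomial.X ^ 2 : Polynomial ℝ).natDegree ≤ 2 := by compute_degree
  refine ⟨Polynomial.C (a 0) + ∑ j ∈ Finset.Icc 1 n, Polynomial.C (a j) *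
      (Polynomial.Chebyshev.T ℝ j).comp (1 - 2 * Polynomial.X ^ 2),
    ∑ j ∈ Finset.Icc 1 n, Polynomial.C (b j) * (2 * Polynomial.X *
      (Polynomial.Chebyshev.U ℝ ((j - 1 : ℕ) : ℤ)).comp (1 - 2 * Polynomial.X ^ 2)), ?_, ?_, ?_, ?_, ?_⟩
  · refine (Polynomial.natDegree_add_le _ _).trans (max_le (by simp) ?_)
    refine Polynomial.natDegree_sum_le_of_forall_le _ _ fun j hj => ?_
    rw [Finset.mem_Icc] at hj
    refine (Polynomial.natDegree_C_mul_le _ _).trans ?_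
    rw [Polynomial.natDegree_comp, Polynomial.Chebyshev.natDegree_T]
    calc _ ≤ n * 2 := Nat.mul_le_mul (by simpa using hj.2) hX
      _ = _ := by ring
  · refine Polynomial.natDegree_sum_le_of_forall_le _ _ fun j hj => ?_
    rw [Finset.mem_Icc] at hj
    refine (Polynomial.natDegree_C_mul_le _ _).trans ?_
    refine Polynomial.natDegree_mul_le.trans ?_
    have h1 : (2 * Polynomial.X : Polynomial ℝ).natDegree ≤ 1 := by compute_degree
    rw [Polynomial.natDegree_comp, Polynomial.Chebyshev.natDegree_U_natCast]
    have := Nat.mul_le_mul (le_refl (j - 1)) hX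
    omega
  · intro x
    simp [Polynomial.eval_finsetSum]
  · intro x
    simp [Polynomial.eval_finsetSum]
  · intro θ
    have hc : 1 - 2 * Real.sin (θ / 2) ^ 2 = Real.cos θ := by
      have h1 := Real.cos_two_mul (θ / 2)
      have h2 := Real.sin_sq_add_cos_sq (θ / 2)
      rw [show 2 * (θ / 2) = θ by ring] at h1
      linarith
    have hs : Real.sin θ = 2 * Real.sin (θ / 2) * Real.cos (θ / 2) := by
      rw [← Real.sin_two_mul]; ring_nf
    simp only [Polynomial.eval_add, Polynomial.eval_C, Polynomial.eval_finsetSum, Polynomial.eval_mul,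
      Polynomial.eval_comp, Polynomial.eval_sub, Polynomial.eval_one, Polynomial.eval_pow,
      Polynomial.eval_X, Polynomial.eval_ofNat, hc]
    rw [Finset.sum_add_distrib, Finset.mul_sum, add_assoc]
    congr 1
    congr 1
    · refine Finset.sum_congr rfl fun j hj => ?_
      rw [Polynomial.Chebyshev.T_real_cos]; simp
    · refine Finset.sum_congr rfl fun j hj => ?_
      rw [Finset.mem_Icc] at hj
      have := Polynomial.Chebyshev.U_real_cos θ ((j - 1 : ℕ) : ℤ)
      have hj' : (((j - 1 : ℕ) : ℤ) : ℝ) + 1 = j := by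
        rw [Int.cast_natCast, Nat.cast_sub hj.1]; simp
      rw [hj', hs] at this
      rw [← this]; ring

set_option maxHeartbeats 1000000 in
lemma trig_small (n : ℕ) (hn : 0 < n) (T : ℝ → ℝ) (hT : IsTrigPoly n T) (M b : ℝ) (hb : 0 < b)
    (hb2 : b ≤ Real.pi / 2) (hM : ∀ θ, |θ| ≤ b → |T θ| ≤ M) (θ : ℝ) (hθ : |θ| < b) :
    |deriv T θ| * rhoStar n (b - |θ|) ≤ 1700 * M / b := by
  obtain ⟨P, R, hPd, hRd, hPe, hRo, hTe⟩ := trig_decomp n T hT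
  have hpi := Real.pi_pos
  have hpi2 := Real.pi_lt_d2
  have hM0 : 0 ≤ M := (abs_nonneg _).trans (hM 0 (by simpa using hb.le))
  have hTn : ∀ θ, T (-θ) = P.eval (Real.sin (θ / 2)) - Real.cos (θ / 2) * R.eval (Real.sin (θ / 2)) := by
    intro θ
    rw [hTe, neg_div, Real.sin_neg, Real.cos_neg, hPe, hRo]; ring
  set a := Real.sin (b / 2) with ha_def
  have ha : b / Real.pi ≤ a := by
    have := Real.mul_le_sin (x := b / 2) (by linarith) (by linarith)
    calc b / Real.pi = 2 / Real.pi * (b / 2) := by ring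
      _ ≤ _ := this
  have ha0 : 0 < a := lt_of_lt_of_le (by positivity) ha
  have ha1 : a ≤ 1 := Real.sin_le_one _
  -- every point of [-a,a] is a sine
  have hsurj : ∀ x, |x| ≤ a → ∃ t, |t| ≤ b ∧ Real.sin (t / 2) = x := by
    intro x hx
    rw [abs_le] at hx
    refine ⟨2 * Real.arcsin x, ?_, ?_⟩
    · have h1 : Real.arcsin x ≤ b / 2 :=
        (Real.arcsin_le_iff_le_sin' ⟨by linarith, by linarith⟩).2 hx.2
      have h2 : -(b / 2) ≤ Real.arcsin x :=
        (Real.le_arcsin_iff_sin_le' ⟨by linarith, by linarith⟩).2 (by rw [Real.sin_neg]; exact hx.1)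
      rw [abs_le]; constructor <;> linarith
    · rw [mul_div_cancel_left₀ _ two_ne_zero, Real.sin_arcsin (by linarith) (by linarith)]
  have hcos : ∀ t, |t| ≤ b → 1 / 2 ≤ Real.cos (t / 2) := by
    intro t ht
    rw [← Real.cos_pi_div_three, ← Real.cos_abs (t / 2), abs_div, abs_two]
    apply Real.cos_le_cos_of_nonneg_of_le_pi
    · positivity
    · linarith
    · linarith
  have hPM : ∀ x, |x| ≤ a → |P.eval x| ≤ M := by
    intro x hx
    obtain ⟨t, ht, rfl⟩ := hsurj x hx
    have h1 := hM t ht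
    have h2 := hM (-t) (by rwa [abs_neg])
    rw [hTn] at h2
    rw [hTe] at h1
    rw [abs_le] at *
    constructor <;> linarith
  have hRM : ∀ x, |x| ≤ a → |R.eval x| ≤ 2 * M := by
    intro x hx
    obtain ⟨t, ht, rfl⟩ := hsurj x hx
    have h1 := hM t ht
    have h2 := hM (-t) (by rwa [abs_neg])
    rw [hTn] at h2
    rw [hTe] at h1
    have h3 : |Real.cos (t / 2) * R.eval (Real.sin (t / 2))| ≤ M := by
      rw [abs_le] at *
      constructor <;> linarith
    have hc := hcos t ht
    rw [abs_mul, abs_of_pos (by linarith)] at h3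
    nlinarith [abs_nonneg (R.eval (Real.sin (t / 2)))]
  set x := Real.sin (θ / 2) with hx_def
  have hxa : |x| < a := by
    rw [abs_lt] at hθ ⊢
    constructor
    · rw [ha_def, ← Real.sin_neg]
      exact Real.sin_lt_sin_of_lt_of_le_pi_div_two (by linarith) (by linarith) (by linarith)
    · exact Real.sin_lt_sin_of_lt_of_le_pi_div_two (by linarith) (by linarith) (by linarith)
  obtain ⟨p1, p2⟩ := poly_scaled (2 * n) (by omega) P hPd M a ha0 hPM x hxa
  obtain ⟨r1, r2⟩ := poly_scaled (2 * n) (by omega) R hRd (2 * M) a ha0 hRM x hxa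
  have hR := hRM x hxa.le
  -- derivative
  have hd : HasDerivAt T (P.derivative.eval x * (Real.cos (θ / 2) * (1 / 2)) +
      ((-Real.sin (θ / 2) * (1 / 2)) * R.eval x +
        Real.cos (θ / 2) * (R.derivative.eval x * (Real.cos (θ / 2) * (1 / 2))))) θ := by
    have h1 : HasDerivAt (fun t : ℝ => t / 2) (1 / 2) θ := (hasDerivAt_id θ).div_const 2
    have hs := h1.sin
    have hc := h1.cos
    have hP' := (P.hasDerivAt (Real.sin (θ / 2))).comp θ hs
    have hR' := (R.hasDerivAt (Real.sin (θ / 2))).comp θ hs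
    have := hP'.add (hc.mul hR')
    rw [show T = _ from funext hTe]
    exact this
  have hD : |deriv T θ| ≤ M + 1 / 2 * |P.derivative.eval x| + 1 / 2 * |R.derivative.eval x| := by
    rw [hd.deriv]
    have hc1 := Real.abs_cos_le_one (θ / 2)
    have hs1 := Real.abs_sin_le_one (θ / 2)
    refine (abs_add_le _ _).trans ?_
    have e1 : |P.derivative.eval x * (Real.cos (θ / 2) * (1 / 2))| ≤ 1 / 2 * |P.derivative.eval x| := by
      rw [abs_mul, abs_mul, abs_of_pos (by norm_num : (0:ℝ) < 1 / 2)]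
      nlinarith [abs_nonneg (P.derivative.eval x)]
    have e2 : |(-Real.sin (θ / 2) * (1 / 2)) * R.eval x| ≤ M := by
      rw [abs_mul, abs_mul, abs_neg, abs_of_pos (by norm_num : (0:ℝ) < 1 / 2)]
      nlinarith [abs_nonneg (R.eval x)]
    have e3 : |Real.cos (θ / 2) * (R.derivative.eval x * (Real.cos (θ / 2) * (1 / 2)))|
        ≤ 1 / 2 * |R.derivative.eval x| := by
      rw [abs_mul, abs_mul, abs_mul, abs_of_pos (by norm_num : (0:ℝ) < 1 / 2)]
      have : |Real.cos (θ / 2)| * |Real.cos (θ / 2)| ≤ 1 := by nlinarith [abs_nonneg (Real.cos (θ / 2))]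
      nlinarith [abs_nonneg (R.derivative.eval x)]
    have := (abs_add_le ((-Real.sin (θ / 2) * (1 / 2)) * R.eval x)
      (Real.cos (θ / 2) * (R.derivative.eval x * (Real.cos (θ / 2) * (1 / 2)))))
    linarith
  set D := |deriv T θ|
  have hD0 : 0 ≤ D := abs_nonneg _
  set S := √(a ^ 2 - x ^ 2) with hS
  have hS0 : 0 ≤ S := Real.sqrt_nonneg _
  have hS1 : S ≤ 1 := by
    rw [hS, Real.sqrt_le_iff]
    constructor
    · norm_num
    · nlinarith [sq_nonneg x]
  push_cast at p1 p2 r1 r2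
  have hn1 : (1:ℝ) ≤ n := by exact_mod_cast hn
  have hn0 : (0:ℝ) < n := by linarith
  have hSD : S * D ≤ 22 * n * M := by
    have : S * D ≤ S * (M + 1 / 2 * |P.derivative.eval x| + 1 / 2 * |R.derivative.eval x|) := by gcongr
    nlinarith [mul_nonneg hM0 hS0]
  have haD : a * D ≤ a * M + 468 * n ^ 2 * M := by
    have : a * D ≤ a * (M + 1 / 2 * |P.derivative.eval x| + 1 / 2 * |R.derivative.eval x|) := by gcongr
    nlinarith
  set t := b - |θ| with ht
  have ht0 : 0 ≤ t := by linarith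
  -- lower bound for S
  have hSt : √t * √b ≤ Real.pi * S := by
    have h1 : a ^ 2 - x ^ 2 = Real.sin ((b - |θ|) / 2) * Real.sin ((b + |θ|) / 2) := by
      have hx2 : x ^ 2 = Real.sin (|θ| / 2) ^ 2 := by
        rw [hx_def]
        rcases abs_choice θ with h | h <;> rw [h]
        rw [neg_div, Real.sin_neg, neg_sq]
      rw [hx2, ha_def, show (b - |θ|) / 2 = b / 2 - |θ| / 2 by ring,
        show (b + |θ|) / 2 = b / 2 + |θ| / 2 by ring, Real.sin_sub, Real.sin_add]
      have q1 := Real.sin_sq_add_cos_sq (b / 2)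
      have q2 := Real.sin_sq_add_cos_sq (|θ| / 2)
      linear_combination (-Real.sin (b / 2) ^ 2) * q2 + (Real.sin (|θ| / 2) ^ 2) * q1
    have hab := abs_nonneg θ
    have s1 := Real.mul_le_sin (x := (b - |θ|) / 2) (by linarith) (by linarith)
    have s2 := Real.mul_le_sin (x := (b + |θ|) / 2) (by linarith) (by linarith)
    have s3 : t / Real.pi * (b / Real.pi) ≤ a ^ 2 - x ^ 2 := by
      rw [h1]
      refine mul_le_mul ?_ ?_ (by positivity) ?_
      · refine le_trans (le_of_eq ?_) s1; rw [ht]; ring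
      · refine le_trans ?_ s2
        calc b / Real.pi ≤ (b + |θ|) / Real.pi := by gcongr; linarith
          _ = _ := by ring
      · exact le_trans (mul_nonneg (by positivity) (by linarith)) s1
    rw [← Real.sqrt_mul ht0]
    apply Real.sqrt_le_iff.2
    refine ⟨by positivity, ?_⟩
    rw [mul_pow, hS, Real.sq_sqrt (le_trans (by positivity) s3)]
    calc t * b = Real.pi ^ 2 * (t / Real.pi * (b / Real.pi)) := by field_simp
      _ ≤ _ := by gcongr
  have hsb : √b ≤ 2 := by rw [Real.sqrt_le_iff]; constructor <;> linarith
  have hsb0 : 0 < √b := Real.sqrt_pos.2 hb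
  have hbb : √b * √b = b := Real.mul_self_sqrt hb.le
  have f1 : b * D ≤ b * M + 1475 * n ^ 2 * M := by
    have g1 : b ≤ Real.pi * a := by rw [div_le_iff₀ hpi] at ha; linarith
    have g2 : D - M ≤ 468 * n ^ 2 * M / a := by rw [le_div_iff₀ ha0]; linarith
    have g3 : b * (468 * n ^ 2 * M / a) ≤ Real.pi * a * (468 * n ^ 2 * M / a) := by gcongr
    have g4 : Real.pi * a * (468 * n ^ 2 * M / a) = Real.pi * (468 * n ^ 2 * M) := by field_simp
    have g5 : Real.pi * (468 * n ^ 2 * M) ≤ 3.15 * (468 * n ^ 2 * M) := by gcongr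
    have g6 : b * (D - M) ≤ b * (468 * n ^ 2 * M / a) := by gcongr
    have g7 : 0 ≤ (n:ℝ) ^ 2 * M := by positivity
    linarith
  have f2 : b * (√t * D) ≤ 140 * n * M := by
    have g1 : √t * √b * D ≤ Real.pi * S * D := by gcongr
    have g2 : Real.pi * S * D ≤ 3.15 * (22 * n * M) := by
      calc Real.pi * S * D = Real.pi * (S * D) := by ring
        _ ≤ _ := by gcongr
    have g3 : b * (√t * D) = √b * (√t * √b * D) := by linear_combination (-(√t * D)) * hbb
    rw [g3]
    have g4 := g1.trans g2
    calc √b * (√t * √b * D) ≤ 2 * (3.15 * (22 * n * M)) :=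
          mul_le_mul hsb g4 (by positivity) (by norm_num)
      _ ≤ _ := by
        have := mul_nonneg hn0.le hM0
        linarith
  rw [le_div_iff₀ hb, rhoStar]
  have k1 : (n:ℝ)⁻¹ ^ 2 * (b * D) ≤ (n:ℝ)⁻¹ ^ 2 * (b * M + 1475 * n ^ 2 * M) := by gcongr
  have k2 : (n:ℝ)⁻¹ * (b * (√t * D)) ≤ (n:ℝ)⁻¹ * (140 * n * M) := by gcongr
  have k3 : (n:ℝ)⁻¹ ^ 2 * (b * M + 1475 * n ^ 2 * M) = (n:ℝ)⁻¹ ^ 2 * (b * M) + 1475 * M := by field_simp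
  have k4 : (n:ℝ)⁻¹ * (140 * n * M) = 140 * M := by field_simp
  have k5 : (n:ℝ)⁻¹ ^ 2 * (b * M) ≤ 1 * (2 * M) := by
    gcongr
    · exact pow_le_one₀ (by positivity) (inv_le_one_of_one_le₀ hn1)
    · linarith
  calc D * ((n:ℝ)⁻¹ ^ 2 + (n:ℝ)⁻¹ * √t) * b
      = (n:ℝ)⁻¹ ^ 2 * (b * D) + (n:ℝ)⁻¹ * (b * (√t * D)) := by ring
    _ ≤ 1700 * M := by linarith

lemma trig_shift (n : ℕ) (T : ℝ → ℝ) (hT : IsTrigPoly n T) (s : ℝ) :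
    IsTrigPoly n (fun x => T (x + s)) := by
  obtain ⟨a, b, rfl⟩ := hT
  refine ⟨fun j => if j = 0 then a 0 else a j * Real.cos (j * s) + b j * Real.sin (j * s),
    fun j => b j * Real.cos (j * s) - a j * Real.sin (j * s), ?_⟩
  funext x
  simp only [if_true]
  congr 1
  refine Finset.sum_congr rfl fun j hj => ?_
  rw [Finset.mem_Icc] at hj
  rw [if_neg (by omega), mul_add, Real.cos_add, Real.sin_add]
  ring

lemma trig_cont (n : ℕ) (T : ℝ → ℝ) (hT : IsTrigPoly n T) : Continuous T := by
  obtain ⟨a, b, rfl⟩ := hT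
  fun_prop

/-- **Videnskii-type inequality.** There exists `c̃ : (0,π) → (0,∞)`, decreasing in `β`,
such that for every `β ∈ (0,π)`, every `n ≥ 1`, every real trigonometric polynomial `T` of
degree at most `n` and every `θ ∈ (-β,β)`,
`|T'(θ)| ≤ c̃(β) ‖T‖_{L^∞([-β,β])} / ρ_n^*(β - |θ|)`. -/
theorem stmt_12 :
    ∃ c : ℝ → ℝ, (∀ β ∈ Ioo (0 : ℝ) Real.pi, 0 < c β) ∧
      AntitoneOn c (Ioo (0 : ℝ) Real.pi) ∧
      ∀ β ∈ Ioo (0 : ℝ) Real.pi, ∀ n : ℕ, 0 < n → ∀ T : ℝ → ℝ, IsTrigPoly n T →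
        ∀ θ ∈ Ioo (-β) β,
          |deriv T θ| ≤
            c β * sSup ((fun t => |T t|) '' Icc (-β) β) / rhoStar n (β - |θ|) := by
  refine ⟨fun β => 6800 / β, fun β hβ => div_pos (by norm_num) hβ.1, ?_, ?_⟩
  · intro x hx y hy hxy
    exact div_le_div_of_nonneg_left (by norm_num) hx.1 hxy
  intro β hβ n hn T hT θ hθ
  have hβ0 := hβ.1
  set M := sSup ((fun t => |T t|) '' Icc (-β) β) with hMdef
  have hbdd : BddAbove ((fun t => |T t|) '' Icc (-β) β) :=
    (isCompact_Icc.image (trig_cont n T hT).abs).bddAbove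
  have hM : ∀ t, -β ≤ t → t ≤ β → |T t| ≤ M := fun t h1 h2 =>
    le_csSup hbdd ⟨t, ⟨h1, h2⟩, rfl⟩
  have hn0 : (0:ℝ) < n := by exact_mod_cast hn
  have hθ' : |θ| < β := abs_lt.2 hθ
  obtain ⟨s, hs1, hs2, hs3, hs4⟩ : ∃ s, |s| ≤ β / 2 ∧ |θ - s| < β / 2 ∧
      (β - |θ|) / 2 ≤ β / 2 - |θ - s| ∧ True := by
    rcases le_total |θ| (β / 2) with h | h
    · exact ⟨θ, h, by simpa using by linarith, by simp; linarith [abs_nonneg θ], trivial⟩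
    · rcases le_total 0 θ with h0 | h0
      · rw [abs_of_nonneg h0] at *
        refine ⟨β / 2, ?_, ?_, ?_, trivial⟩
        · rw [abs_of_pos (by linarith)]
        · rw [abs_of_nonneg (by linarith)]; linarith
        · rw [abs_of_nonneg (by linarith)]; linarith
      · rw [abs_of_nonpos h0] at *
        refine ⟨-(β / 2), ?_, ?_, ?_, trivial⟩
        · rw [abs_neg, abs_of_pos (by linarith)]
        · rw [abs_of_nonpos (by linarith)]; linarith
        · rw [abs_of_nonpos (by linarith)]; linarith
  rw [abs_le] at hs1
  have key := trig_small n hn _ (trig_shift n T hT s) M (β / 2) (by linarith) (by linarith [hβ.2]) (by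
    intro t ht
    rw [abs_le] at ht
    exact hM _ (by linarith) (by linarith)) (θ - s) hs2
  rw [deriv_comp_add_const, sub_add_cancel] at key
  have hρ : rhoStar n (β - |θ|) ≤ 2 * rhoStar n (β / 2 - |θ - s|) := by
    have h1 : √(β - |θ|) ≤ 2 * √(β / 2 - |θ - s|) := by
      rw [Real.sqrt_le_iff]
      refine ⟨by positivity, ?_⟩
      rw [mul_pow, Real.sq_sqrt (by linarith)]
      linarith
    unfold rhoStar
    have h2 : (n:ℝ)⁻¹ * √(β - |θ|) ≤ (n:ℝ)⁻¹ * (2 * √(β / 2 - |θ - s|)) := by gcongr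
    have h3 : 0 ≤ (n:ℝ)⁻¹ ^ 2 := by positivity
    linarith
  have hρ0 : 0 < rhoStar n (β - |θ|) := by unfold rhoStar; positivity
  rw [le_div_iff₀ hρ0]
  calc |deriv T θ| * rhoStar n (β - |θ|) ≤ |deriv T θ| * (2 * rhoStar n (β / 2 - |θ - s|)) := by gcongr
    _ = 2 * (|deriv T θ| * rhoStar n (β / 2 - |θ - s|)) := by ring
    _ ≤ 2 * (1700 * M / (β / 2)) := by gcongr
    _ = 6800 / β * M := by field_simp; ring
end

section
/- Let 0 < δ ≤ R, let D ⊂ ℝ² be a compact set, and let x ∈ D be such that δB + x ⊂ D ⊂ RB + x, where B is the closed unit disc. Then there is a constant c(δ,R) > 0 depending only on δ and R such that for every positive integer n, c(δ,R)^{-1} n^{-2} ≤ λ_n(D,x) ≤ c(δ,R) n^{-2}. -/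
open MeasureTheory Set

section aux
open Polynomial Polynomial.Chebyshev

lemma cheb_expand (N : ℕ) (p : ℝ[X]) (hp : p.natDegree < N) :
    ∃ c : ℕ → ℝ, p = ∑ k ∈ Finset.range N, c k • T ℝ (k : ℤ) := by
  have h := (chebyshevTsequence ℝ).span_degreeLT (m := N) (fun i _ => by
    rw [isUnit_iff_ne_zero]; simp)
  have hm : p ∈ degreeLT ℝ N := by
    rw [mem_degreeLT]
    exact lt_of_le_of_lt degree_le_natDegree (by exact_mod_cast hp)
  rw [← h, ← Finset.coe_Iio, Submodule.mem_span_image_finset_iff_exists_fun] at hm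
  obtain ⟨c, hc⟩ := hm
  refine ⟨fun k => if h : k ∈ Finset.Iio N then c ⟨k, h⟩ else 0, hc.symm.trans ?_⟩
  rw [show Finset.range N = Finset.Iio N by ext; simp, ← Finset.sum_coe_sort (Finset.Iio N)]
  refine Finset.sum_congr rfl fun k _ => ?_
  beta_reduce
  rw [dif_pos k.2]; rfl

lemma cheb_sq (s : Finset ℕ) (c : ℕ → ℝ) :
    ∫ x, ((∑ k ∈ s, c k • T ℝ (k : ℤ)).eval x) ^ 2 ∂measureT
      = ∑ k ∈ s, c k ^ 2 * (if k = 0 then Real.pi else Real.pi / 2) := by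
  have h1 : ∀ x : ℝ, ((∑ k ∈ s, c k • T ℝ (k : ℤ)).eval x) ^ 2 =
      ∑ k ∈ s, ∑ l ∈ s, c k * c l * ((T ℝ (k : ℤ)).eval x * (T ℝ (l : ℤ)).eval x) := by
    intro x
    rw [eval_finsetSum, sq, Finset.sum_mul_sum]
    refine Finset.sum_congr rfl fun k _ => Finset.sum_congr rfl fun l _ => ?_
    simp only [eval_smul, smul_eq_mul]; ring
  simp_rw [h1]
  have hi : ∀ k l : ℕ, Integrable (fun x => c k * c l * ((T ℝ (k : ℤ)).eval x * (T ℝ (l : ℤ)).eval x)) measureT :=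
    fun k l => integrable_measureT (by fun_prop)
  rw [integral_finsetSum _ (fun k _ => integrable_finsetSum _ fun l _ => hi k l)]
  refine Finset.sum_congr rfl fun k hk => ?_
  rw [integral_finsetSum _ (fun l _ => hi k l), Finset.sum_eq_single k]
  · rw [integral_const_mul]
    split_ifs with h
    · subst h
      have := integral_eval_T_real_mul_self_measureT_zero
      simp only [Nat.cast_zero]
      rw [this]; ring
    · rw [integral_T_real_mul_self_measureT_of_ne_zero h]; ring
  · intro l _ hl
    rw [integral_const_mul, integral_eval_T_real_mul_eval_T_real_measureT_of_ne hl.symm, mul_zero]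
  · exact fun h => absurd hk h

lemma subst_cos (g : ℝ → ℝ) (hg : Continuous g) :
    ∫ t in (-1)..1, g t = ∫ θ in (0)..Real.pi, g (Real.cos θ) * Real.sin θ := by
  have := intervalIntegral.integral_comp_mul_deriv (a := 0) (b := Real.pi) (f := Real.cos)
    (f' := fun θ => -Real.sin θ) (g := g) (fun x _ => Real.hasDerivAt_cos x) (by fun_prop) hg
  rw [Real.cos_zero, Real.cos_pi, intervalIntegral.integral_symm (-1) 1] at this
  simp only [mul_neg, intervalIntegral.integral_neg, neg_inj, Function.comp] at this
  exact this.symm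

/-- 1D upper bound polynomial. -/
lemma upper1 (m : ℕ) : ∃ f : ℝ[X], f.natDegree ≤ 2 * m ∧ f.eval 0 = 1 ∧
    ∫ t in (-1)..1, (f.eval t) ^ 2 ≤ Real.pi / (m + 1) := by
  classical
  let s : Finset ℕ := (Finset.range (m + 1)).image (fun k => 2 * k)
  let c : ℕ → ℝ := fun k => (T ℝ (k : ℤ)).eval 0 / (m + 1)
  have hinj : Function.Injective (fun k : ℕ => 2 * k) := fun a b h => by simpa using h
  have hsq : ∀ k : ℕ, ((T ℝ ((2 * k : ℕ) : ℤ)).eval 0) ^ 2 = 1 := by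
    intro k
    push_cast
    rw [T_eval_two_mul_zero]
    rcases Int.units_eq_one_or (Int.negOnePow (k : ℤ)) with h | h <;> rw [h] <;> simp
  have hm : (0 : ℝ) < m + 1 := by positivity
  refine ⟨∑ k ∈ s, c k • T ℝ (k : ℤ), ?_, ?_, ?_⟩
  · apply natDegree_sum_le_of_forall_le
    intro k hk
    refine (natDegree_smul_le _ _).trans ?_
    simp only [s, Finset.mem_image, Finset.mem_range] at hk
    obtain ⟨j, hj, rfl⟩ := hk
    simp only [natDegree_T]; omega
  · rw [eval_finsetSum, Finset.sum_image hinj.injOn]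
    have : ∀ k : ℕ, (c (2 * k) • T ℝ ((2 * k : ℕ) : ℤ)).eval 0 = 1 / (m + 1) := by
      intro k
      have h := hsq k
      simp only [c, eval_smul, smul_eq_mul]
      rw [div_mul_eq_mul_div, ← sq, h]
    simp_rw [this]
    simp; field_simp
  · rw [subst_cos _ (by fun_prop)]
    calc _ ≤ ∫ θ in (0)..Real.pi, (eval (Real.cos θ) (∑ k ∈ s, c k • T ℝ (k : ℤ))) ^ 2 := by
          apply intervalIntegral.integral_mono_on Real.pi_pos.le
          · exact Continuous.intervalIntegrable (by fun_prop) _ _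
          · exact Continuous.intervalIntegrable (by fun_prop) _ _
          · intro θ _
            exact mul_le_of_le_one_right (sq_nonneg _) (Real.sin_le_one θ)
      _ = _ := by
          rw [← integral_measureT_eq_integral_cos (f := fun x => (eval x (∑ k ∈ s, c k • T ℝ (k : ℤ))) ^ 2)]
      _ = _ := cheb_sq s c
      _ ≤ ∑ k ∈ Finset.range (m + 1), (1 / (m + 1) ^ 2 * Real.pi) := by
          rw [Finset.sum_image hinj.injOn]
          apply Finset.sum_le_sum
          intro k _
          have : c (2 * k) ^ 2 = 1 / (m + 1) ^ 2 := by
            simp only [c, div_pow, hsq k]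
          rw [this]
          gcongr
          split_ifs
          · exact le_rfl
          · linarith [Real.pi_pos]
      _ = _ := by simp; field_simp

/-- 1D lower bound. -/
lemma lower1 (n : ℕ) (p : ℝ[X]) (hp : p.natDegree ≤ n) :
    (p.eval 0) ^ 2 ≤ (n + 3) * ∫ t in (-1)..1, (p.eval t) ^ 2 := by
  set q : ℝ[X] := p * (1 - X ^ 2) with hq
  have hqd : q.natDegree < n + 3 := by
    have h1 : (1 - X ^ 2 : ℝ[X]).natDegree ≤ 2 := by compute_degree
    have := natDegree_mul_le (p := p) (q := (1 - X ^ 2 : ℝ[X]))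
    rw [← hq] at this
    omega
  obtain ⟨c, hc⟩ := cheb_expand _ _ hqd
  have hT : ∀ k : ℕ, ((T ℝ (k : ℤ)).eval 0) ^ 2 ≤ 1 := by
    intro k
    have := T_real_cos (Real.pi / 2) k
    rw [Real.cos_pi_div_two] at this
    rw [this]; exact Real.cos_sq_le_one _
  have h0 : p.eval 0 = ∑ k ∈ Finset.range (n + 3), c k * (T ℝ (k : ℤ)).eval 0 := by
    have : p.eval 0 = q.eval 0 := by simp [hq]
    rw [this, hc, eval_finsetSum]; simp
  have hI : ∑ k ∈ Finset.range (n + 3), c k ^ 2 ≤ ∫ t in (-1)..1, (p.eval t) ^ 2 := by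
    calc _ ≤ ∑ k ∈ Finset.range (n + 3), c k ^ 2 * (if k = 0 then Real.pi else Real.pi / 2) := by
          apply Finset.sum_le_sum
          intro k _
          apply le_mul_of_one_le_right (sq_nonneg _)
          split_ifs <;> linarith [Real.pi_gt_three]
      _ = ∫ x, (q.eval x) ^ 2 ∂measureT := by rw [← cheb_sq, ← hc]
      _ = ∫ θ in (0)..Real.pi, (q.eval (Real.cos θ)) ^ 2 :=
          integral_measureT_eq_integral_cos (f := fun x => (q.eval x) ^ 2)
      _ ≤ ∫ θ in (0)..Real.pi, (p.eval (Real.cos θ)) ^ 2 * Real.sin θ := by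
          apply intervalIntegral.integral_mono_on Real.pi_pos.le
          · exact Continuous.intervalIntegrable (by fun_prop) _ _
          · exact Continuous.intervalIntegrable (by fun_prop) _ _
          · intro θ hθ
            have hs := Real.sin_nonneg_of_mem_Icc hθ
            have hs1 := Real.sin_le_one θ
            have : q.eval (Real.cos θ) = p.eval (Real.cos θ) * Real.sin θ ^ 2 := by
              rw [Real.sin_sq]; simp [hq]
            rw [this, mul_pow]
            apply mul_le_mul_of_nonneg_left _ (sq_nonneg _)
            rw [← pow_mul]
            exact pow_le_of_le_one hs hs1 (by norm_num)
      _ = _ := (subst_cos (fun t => (p.eval t) ^ 2) (by fun_prop)).symm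
  calc _ ≤ (∑ k ∈ Finset.range (n + 3), c k ^ 2) *
        ∑ k ∈ Finset.range (n + 3), ((T ℝ (k : ℤ)).eval 0) ^ 2 := by
        rw [h0]; exact Finset.sum_mul_sq_le_sq_mul_sq _ _ _
    _ ≤ (∑ k ∈ Finset.range (n + 3), c k ^ 2) * ∑ k ∈ Finset.range (n + 3), 1 := by
        gcongr; exact hT _
    _ = (n + 3) * ∑ k ∈ Finset.range (n + 3), c k ^ 2 := by simp; ring
    _ ≤ _ := by gcongr

/-- Scaled 1D lower bound. -/
lemma lower1' (n : ℕ) (p : ℝ[X]) (hp : p.natDegree ≤ n) (a s : ℝ) (ha : 0 < a) :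
    (p.eval s) ^ 2 ≤ (n + 3) / a * ∫ t in Icc (s - a) (s + a), (p.eval t) ^ 2 := by
  have h := lower1 n (p.comp (C a * X + C s)) (by
    rw [natDegree_comp]
    have : (C a * X + C s : ℝ[X]).natDegree ≤ 1 := by compute_degree
    nlinarith)
  simp only [eval_comp, eval_add, eval_mul, eval_C, eval_X, mul_zero, zero_add] at h
  rw [intervalIntegral.integral_comp_mul_add (fun t => (p.eval t) ^ 2) ha.ne'] at h
  rw [integral_Icc_eq_integral_Ioc, ← intervalIntegral.integral_of_le (by linarith)]
  refine h.trans (le_of_eq ?_)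
  rw [smul_eq_mul, show a * (-1) + s = s - a by ring, show a * 1 + s = s + a by ring]
  ring


/-- The axis-parallel square centred at `x` with half-side `r`. -/
def sqr (x : EuclideanSpace ℝ (Fin 2)) (r : ℝ) : Set (EuclideanSpace ℝ (Fin 2)) :=
  {y | y 0 ∈ Icc (x 0 - r) (x 0 + r) ∧ y 1 ∈ Icc (x 1 - r) (x 1 + r)}

lemma sqr_meas (x : EuclideanSpace ℝ (Fin 2)) (r : ℝ) : MeasurableSet (sqr x r) := by
  apply MeasurableSet.inter
  · exact measurableSet_Icc.preimage (f := fun y : EuclideanSpace ℝ (Fin 2) => y 0) (by fun_prop)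
  · exact measurableSet_Icc.preimage (f := fun y : EuclideanSpace ℝ (Fin 2) => y 1) (by fun_prop)

lemma ball_sub_sqr (x : EuclideanSpace ℝ (Fin 2)) (r : ℝ) : Metric.closedBall x r ⊆ sqr x r := by
  intro y hy
  rw [Metric.mem_closedBall, dist_eq_norm] at hy
  have h : ∀ i, |y i - x i| ≤ r := fun i => by
    have := PiLp.norm_apply_le (y - x) i
    simpa using this.trans hy
  have h0 := abs_le.1 (h 0)
  have h1 := abs_le.1 (h 1)
  exact ⟨⟨by linarith, by linarith⟩, ⟨by linarith, by linarith⟩⟩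

lemma sqr_sub_ball (x : EuclideanSpace ℝ (Fin 2)) (r : ℝ) (hr : 0 ≤ r) :
    sqr x (r / 2) ⊆ Metric.closedBall x r := by
  rintro y ⟨⟨h1, h2⟩, ⟨h3, h4⟩⟩
  rw [Metric.mem_closedBall, EuclideanSpace.dist_eq]
  apply Real.sqrt_le_iff.2 ⟨hr, ?_⟩
  simp only [Fin.sum_univ_two, Real.dist_eq, sq_abs]
  nlinarith

lemma sqr_bdd (x : EuclideanSpace ℝ (Fin 2)) (r : ℝ) (hr : 0 ≤ r) :
    sqr x r ⊆ Metric.closedBall x (2 * r) := by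
  have := sqr_sub_ball x (2 * r) (by linarith)
  simpa using this

lemma int2 (x : EuclideanSpace ℝ (Fin 2)) (r : ℝ)
    (F : EuclideanSpace ℝ (Fin 2) → ℝ) (hF : Continuous F) :
    ∫ y in sqr x r, F y = ∫ s in Icc (x 0 - r) (x 0 + r),
      ∫ t in Icc (x 1 - r) (x 1 + r), F !₂[s, t] := by
  have mp := ((volume_preserving_finTwoArrow ℝ).comp
    (EuclideanSpace.volume_preserving_symm_measurableEquiv_toLp (Fin 2)))
  let e := (MeasurableEquiv.toLp 2 (Fin 2 → ℝ)).symm.trans (MeasurableEquiv.finTwoArrow (α := ℝ))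
  have mp' : MeasurePreserving e volume volume := mp
  let G : ℝ × ℝ → ℝ := fun z => F !₂[z.1, z.2]
  have hG : Continuous G := by
    apply hF.comp
    apply (PiLp.continuous_toLp 2 _).comp
    apply continuous_pi
    intro i; fin_cases i <;> simp <;> fun_prop
  have h := mp'.setIntegral_preimage_emb e.measurableEmbedding G
    (Icc (x 0 - r) (x 0 + r) ×ˢ Icc (x 1 - r) (x 1 + r))
  have hFG : ∀ y, G (e y) = F y := by
    intro y
    simp only [G]
    congr 1
    ext i; fin_cases i <;> rfl
  have hset : e ⁻¹' (Icc (x 0 - r) (x 0 + r) ×ˢ Icc (x 1 - r) (x 1 + r)) = sqr x r := rfl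
  simp_rw [hFG, hset] at h
  rw [h, Measure.volume_eq_prod, setIntegral_prod]
  exact hG.continuousOn.integrableOn_compact (isCompact_Icc.prod isCompact_Icc)

lemma evalC (P : MvPolynomial (Fin 2) ℝ) :
    Continuous (fun y : EuclideanSpace ℝ (Fin 2) => MvPolynomial.eval y P) :=
  (MvPolynomial.continuous_eval P).comp (PiLp.continuous_ofLp 2 _)

lemma evalC2 (P : MvPolynomial (Fin 2) ℝ) :
    Continuous (fun y : EuclideanSpace ℝ (Fin 2) => (MvPolynomial.eval y P) ^ 2) :=
  (evalC P).pow 2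

lemma slice (P : MvPolynomial (Fin 2) ℝ) (n : ℕ) (hP : P.totalDegree ≤ n) (g : Fin 2 → ℝ[X])
    (hg : ∀ i, (g i).natDegree ≤ 1) :
    ∃ p : ℝ[X], p.natDegree ≤ n ∧
      ∀ t, p.eval t = MvPolynomial.eval (fun i => (g i).eval t) P := by
  refine ⟨MvPolynomial.aeval g P, by simpa using MvPolynomial.aeval_natDegree_le P hP g hg, ?_⟩
  intro t
  rw [← coe_evalRingHom, MvPolynomial.aeval_def, MvPolynomial.hom_eval₂]
  have : (evalRingHom t).comp (algebraMap ℝ ℝ[X]) = RingHom.id ℝ := by ext; simp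
  rw [this]
  rfl

lemma lower2 (n : ℕ) (P : MvPolynomial (Fin 2) ℝ) (hP : P.totalDegree ≤ n)
    (x : EuclideanSpace ℝ (Fin 2)) (a : ℝ) (ha : 0 < a) :
    (MvPolynomial.eval x P) ^ 2 ≤ ((n + 3) / a) ^ 2 * ∫ y in sqr x a, (MvPolynomial.eval y P) ^ 2 := by
  set K : ℝ := (n + 3) / a with hK
  have hK0 : 0 < K := by positivity
  have hx : (x : Fin 2 → ℝ) = ![x 0, x 1] := by ext i; fin_cases i <;> rfl
  rw [int2 x a _ (evalC2 P)]
  have hv : ∀ s, (MvPolynomial.eval ![s, x 1] P) ^ 2 ≤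
      K * ∫ t in Icc (x 1 - a) (x 1 + a), (MvPolynomial.eval (!₂[s, t] : EuclideanSpace ℝ (Fin 2)) P) ^ 2 := by
    intro s
    obtain ⟨p, hp, hpe⟩ := slice P n hP ![C s, X] (by intro i; fin_cases i <;> simp)
    have h := lower1' n p hp a (x 1) ha
    have h2 : ∀ t, p.eval t = MvPolynomial.eval ![s, t] P := by
      intro t; rw [hpe]; congr 2; ext i; fin_cases i <;> simp
    simp_rw [h2] at h
    exact h
  have hc : Continuous fun z : ℝ × ℝ => (MvPolynomial.eval ![z.1, z.2] P) ^ 2 := by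
    apply Continuous.pow
    apply (MvPolynomial.continuous_eval P).comp
    apply continuous_pi
    intro i; fin_cases i <;> simp <;> fun_prop
  have hh : (MvPolynomial.eval x P) ^ 2 ≤
      K * ∫ s in Icc (x 0 - a) (x 0 + a), (MvPolynomial.eval ![s, x 1] P) ^ 2 := by
    obtain ⟨p, hp, hpe⟩ := slice P n hP ![X, C (x 1)] (by intro i; fin_cases i <;> simp)
    have h := lower1' n p hp a (x 0) ha
    have h2 : ∀ t, p.eval t = MvPolynomial.eval ![t, x 1] P := by
      intro t; rw [hpe]; congr 2; ext i; fin_cases i <;> simp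
    simp_rw [h2] at h
    rw [hx]
    exact h
  refine hh.trans ?_
  rw [sq K, mul_assoc]
  refine mul_le_mul_of_nonneg_left ?_ hK0.le
  rw [← integral_const_mul]
  apply integral_mono_of_nonneg
  · exact Filter.Eventually.of_forall fun s => sq_nonneg _
  · have hi : IntegrableOn (fun z : ℝ × ℝ => (MvPolynomial.eval ![z.1, z.2] P) ^ 2)
        (Icc (x 0 - a) (x 0 + a) ×ˢ Icc (x 1 - a) (x 1 + a)) (volume.prod volume) :=
      hc.continuousOn.integrableOn_compact (isCompact_Icc.prod isCompact_Icc)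
    rw [IntegrableOn, ← Measure.prod_restrict] at hi
    exact hi.integral_prod_left.const_mul K
  · exact Filter.Eventually.of_forall fun s => hv s

lemma upper2 (n : ℕ) (hn : 0 < n) (x : EuclideanSpace ℝ (Fin 2)) (R : ℝ) (hR : 0 < R) :
    ∃ P : MvPolynomial (Fin 2) ℝ, P.totalDegree ≤ n ∧ MvPolynomial.eval x P = 1 ∧
      ∫ y in sqr x R, (MvPolynomial.eval y P) ^ 2 ≤ 16 * Real.pi ^ 2 * R ^ 2 * ((n : ℝ)⁻¹) ^ 2 := by
  obtain ⟨f, hfd, hf0, hfi⟩ := upper1 (n / 4)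
  let L : Fin 2 → MvPolynomial (Fin 2) ℝ := fun i =>
    MvPolynomial.C R⁻¹ * (MvPolynomial.X i - MvPolynomial.C (x i))
  have hL : ∀ i, (L i).totalDegree ≤ 1 := by
    intro i
    refine (MvPolynomial.totalDegree_mul _ _).trans ?_
    rw [MvPolynomial.totalDegree_C, zero_add]
    refine (MvPolynomial.totalDegree_sub _ _).trans ?_
    simp
  have hA : ∀ i, (aeval (L i) f).totalDegree ≤ 2 * (n / 4) := by
    intro i
    rw [aeval_eq_sum_range]
    apply MvPolynomial.totalDegree_finsetSum_le
    intro k hk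
    refine (MvPolynomial.totalDegree_smul_le _ _).trans ((MvPolynomial.totalDegree_pow _ _).trans ?_)
    rw [Finset.mem_range] at hk
    calc k * (L i).totalDegree ≤ k * 1 := Nat.mul_le_mul_left _ (hL i)
      _ ≤ _ := by omega
  have hE : ∀ (i) (y : Fin 2 → ℝ), MvPolynomial.eval y (aeval (L i) f) = f.eval (R⁻¹ * (y i - x i)) := by
    intro i y
    rw [aeval_def, hom_eval₂]
    have : MvPolynomial.eval y (L i) = R⁻¹ * (y i - x i) := by simp [L]
    rw [this, ← eval₂_id]
    congr 1
    ext; simp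
  refine ⟨aeval (L 0) f * aeval (L 1) f, ?_, ?_, ?_⟩
  · refine (MvPolynomial.totalDegree_mul _ _).trans ?_
    have := hA 0
    have := hA 1
    omega
  · rw [map_mul, hE, hE]; simp [hf0]
  · rw [int2 x R _ (evalC2 _)]
    have hJ : ∀ u : ℝ, ∫ t in Icc (u - R) (u + R), (f.eval (R⁻¹ * (t - u))) ^ 2 =
        R * ∫ t in (-1)..1, (f.eval t) ^ 2 := by
      intro u
      rw [integral_Icc_eq_integral_Ioc, ← intervalIntegral.integral_of_le (by linarith)]
      have := intervalIntegral.integral_comp_mul_add (a := u - R) (b := u + R)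
        (fun t => (f.eval t) ^ 2) (inv_ne_zero hR.ne') (-(R⁻¹ * u))
      rw [inv_inv, smul_eq_mul, show R⁻¹ * (u - R) + -(R⁻¹ * u) = -1 by field_simp; ring,
        show R⁻¹ * (u + R) + -(R⁻¹ * u) = 1 by field_simp; ring] at this
      rw [← this]
      congr 1; ext t; congr 2; ring
    have hF : ∀ s t : ℝ, (MvPolynomial.eval (!₂[s, t] : EuclideanSpace ℝ (Fin 2))
        (aeval (L 0) f * aeval (L 1) f)) ^ 2 =
        (f.eval (R⁻¹ * (s - x 0))) ^ 2 * (f.eval (R⁻¹ * (t - x 1))) ^ 2 := by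
      intro s t
      rw [map_mul, hE, hE]; simp [mul_pow]
    simp_rw [hF, integral_const_mul, integral_mul_const, hJ]
    have hm : (n : ℝ) / 4 ≤ ((n / 4 : ℕ) : ℝ) + 1 := by
      have : n ≤ 4 * (n / 4 + 1) := by omega
      have : (n : ℝ) ≤ 4 * (((n / 4 : ℕ) : ℝ) + 1) := by exact_mod_cast this
      linarith
    have hn' : (0 : ℝ) < n := by exact_mod_cast hn
    have hI : ∫ t in (-1)..1, (f.eval t) ^ 2 ≤ 4 * Real.pi * (n : ℝ)⁻¹ := by
      refine hfi.trans ?_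
      calc Real.pi / (((n / 4 : ℕ) : ℝ) + 1) ≤ Real.pi / ((n : ℝ) / 4) :=
            div_le_div_of_nonneg_left Real.pi_pos.le (by positivity) hm
        _ = _ := by field_simp
    have hI0 : 0 ≤ ∫ t in (-1)..1, (f.eval t) ^ 2 :=
      intervalIntegral.integral_nonneg (by norm_num) fun t _ => sq_nonneg _
    calc _ = R ^ 2 * (∫ t in (-1)..1, (f.eval t) ^ 2) ^ 2 := by ring
      _ ≤ R ^ 2 * (4 * Real.pi * (n : ℝ)⁻¹) ^ 2 := by gcongr
      _ = _ := by ring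

end aux

/-- If `δB + x ⊆ D ⊆ RB + x` with `0 < δ ≤ R` and `D ⊂ ℝ²` compact, then
`λ_n(D,x) ≈ n⁻²` with constants depending only on `δ` and `R`. -/
theorem stmt_13 (δ R : ℝ) (hδ : 0 < δ) (hδR : δ ≤ R) :
    ∃ c : ℝ, 0 < c ∧ ∀ D : Set (EuclideanSpace ℝ (Fin 2)), IsCompact D →
      ∀ x : EuclideanSpace ℝ (Fin 2),
        Metric.closedBall x δ ⊆ D → D ⊆ Metric.closedBall x R →
        ∀ n : ℕ, 0 < n →
          c⁻¹ * ((n : ℝ)⁻¹) ^ 2 ≤ christoffel n D x ∧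
          christoffel n D x ≤ c * ((n : ℝ)⁻¹) ^ 2 := by
  have hR : 0 < R := hδ.trans_le hδR
  have hc0 : 0 < 64 / δ ^ 2 := by positivity
  have hc1 : 0 < 16 * Real.pi ^ 2 * R ^ 2 := by positivity
  refine ⟨64 / δ ^ 2 + 16 * Real.pi ^ 2 * R ^ 2, by positivity, ?_⟩
  intro D hD x hδD hDR n hn
  have hn' : (1 : ℝ) ≤ n := by exact_mod_cast hn
  constructor
  · apply le_csInf
    · exact ⟨_, 1, by simp, by simp, rfl⟩
    · rintro I ⟨P, hP, hPx, rfl⟩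
      have h1 := lower2 n P hP x (δ / 2) (by positivity)
      rw [hPx, one_pow] at h1
      have h2 : ∫ y in sqr x (δ / 2), (MvPolynomial.eval y P) ^ 2 ≤
          ∫ y in D, (MvPolynomial.eval y P) ^ 2 := by
        apply setIntegral_mono_set
        · exact ((evalC P).pow 2).continuousOn.integrableOn_compact hD
        · exact Filter.Eventually.of_forall fun y => sq_nonneg _
        · exact HasSubset.Subset.eventuallyLE ((sqr_sub_ball x δ hδ.le).trans hδD)
      set I := ∫ y in D, (MvPolynomial.eval y P) ^ 2
      have h3 : 1 ≤ (64 / δ ^ 2 * n ^ 2) * I := by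
        calc (1 : ℝ) ≤ _ := h1
          _ ≤ ((n + 3) / (δ / 2)) ^ 2 * I := by gcongr
          _ ≤ ((n + 3 * n) / (δ / 2)) ^ 2 * I := by
            have : 0 ≤ I := integral_nonneg fun y => sq_nonneg _
            gcongr; linarith
          _ = _ := by field_simp; ring
      calc _ ≤ (64 / δ ^ 2)⁻¹ * ((n : ℝ)⁻¹) ^ 2 := by gcongr; linarith
        _ = (64 / δ ^ 2 * n ^ 2)⁻¹ := by rw [mul_inv, inv_pow]
        _ ≤ I := by
          rw [inv_le_iff_one_le_mul₀' (by positivity)]; exact h3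
  · obtain ⟨P, hP, hPx, hPi⟩ := upper2 n hn x R hR
    have hb : BddBelow { I : ℝ | ∃ P : MvPolynomial (Fin 2) ℝ, P.totalDegree ≤ n ∧
        MvPolynomial.eval x P = 1 ∧ I = ∫ y in D, (MvPolynomial.eval y P) ^ 2 } := by
      refine ⟨0, ?_⟩
      rintro I ⟨P, -, -, rfl⟩
      exact integral_nonneg fun y => sq_nonneg _
    refine (csInf_le hb ⟨P, hP, hPx, rfl⟩).trans ?_
    have h2 : ∫ y in D, (MvPolynomial.eval y P) ^ 2 ≤
        ∫ y in sqr x R, (MvPolynomial.eval y P) ^ 2 := by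
      apply setIntegral_mono_set
      · exact (((evalC P).pow 2).continuousOn.integrableOn_compact
          (isCompact_closedBall x (2 * R))).mono_set (sqr_bdd x R hR.le)
      · exact Filter.Eventually.of_forall fun y => sq_nonneg _
      · exact HasSubset.Subset.eventuallyLE (hDR.trans (ball_sub_sqr x R))
    refine h2.trans (hPi.trans ?_)
    gcongr
    linarith
end
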